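/- arXiv:2301.00534 — 4 statements merged into one kernel-verified Lean document; each statement's English description precedes it below -/
import Mathlib

section
/- Let C be an additive, idempotent-complete category admitting pseudokernels. An object (X1 →f X2) of H(C) is an indecomposable E^cw-projective object if and only if it is isomorphic in H(C) either to (X →1 X) or to (0 → X) for some indecomposable object X of C; and it is an indecomposable E^cw-injective object if and only if it is isomorphic either to (X →1 X) or to (X → 0) for some indecomposable object X of C. -/
/-!
STATEMENT 1: For an additive, idempotent-complete category C admitting pseudokernels,
an object (X1 →f X2) of H(C) is an indecomposable E^cw-projective object iff it is
isomorphic to (X →1 X) or (0 → X) for some indecomposable X, and an indecomposable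
E^cw-injective object iff it is isomorphic to (X →1 X) or (X → 0) for some
indecomposable X.
-/

open CategoryTheory CategoryTheory.Limits ZeroObject

namespace Statement1

variable {C : Type*} [Category C] [Preadditive C] [HasFiniteBiproducts C]

/-- `(i, p)` is a split short exact sequence in the additive category `C`. -/
def IsSplitSES {A B X : C} (i : A ⟶ B) (p : B ⟶ X) : Prop :=
  i ≫ p = 0 ∧ ∃ (r : B ⟶ A) (s : X ⟶ B),
    i ≫ r = 𝟙 A ∧ s ≫ p = 𝟙 X ∧ r ≫ i + p ≫ s = 𝟙 B

/-- A componentwise split kernel–cokernel pair in the morphism category `Arrow C`: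
both component composable pairs are split short exact sequences in `C`. -/
def IsCwPair {X Z Y : Arrow C} (ι : X ⟶ Z) (π : Z ⟶ Y) : Prop :=
  IsSplitSES ι.left π.left ∧ IsSplitSES ι.right π.right

/-- `P` is `E^cw`-projective: every morphism from `P` to the end term of a
componentwise split kernel–cokernel pair factors through the deflation. -/
def IsCwProjective (P : Arrow C) : Prop :=
  ∀ ⦃X Z Y : Arrow C⦄ (ι : X ⟶ Z) (π : Z ⟶ Y), IsCwPair ι π →
    ∀ t : P ⟶ Y, ∃ l : P ⟶ Z, l ≫ π = t

/-- `I` is `E^cw`-injective: every morphism from the initial term of a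
componentwise split kernel–cokernel pair to `I` factors through the inflation. -/
def IsCwInjective (I : Arrow C) : Prop :=
  ∀ ⦃X Z Y : Arrow C⦄ (ι : X ⟶ Z) (π : Z ⟶ Y), IsCwPair ι π →
    ∀ t : X ⟶ I, ∃ l : Z ⟶ I, ι ≫ l = t

/-- An object of a category is indecomposable if it is nonzero and whenever it is
(the vertex of) a biproduct `U ⊕ V` (equivalently, a binary product, which in the
additive setting is the same thing), one of `U`, `V` is zero. -/
def Indecomposable {D : Type*} [Category D] (W : D) : Prop :=
  ¬ IsZero W ∧ ∀ (U V : D) (p₁ : W ⟶ U) (p₂ : W ⟶ V),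
    Nonempty (IsLimit (BinaryFan.mk p₁ p₂)) → IsZero U ∨ IsZero V

/-- `C` admits pseudokernels. -/
def HasPseudokernels (C : Type*) [Category C] [Preadditive C] : Prop :=
  ∀ ⦃Y Z : C⦄ (g : Y ⟶ Z), ∃ (X : C) (f : X ⟶ Y), f ≫ g = 0 ∧
    ∀ ⦃W : C⦄ (t : W ⟶ Y), t ≫ g = 0 → ∃ s : W ⟶ X, s ≫ f = t

set_option linter.unusedSectionVars false

section Biproducts

variable {D : Type*} [Category D] [Preadditive D]

/-- The maps `i₁, p₁, i₂, p₂` exhibit `W` as a biproduct of `U` and `V`. -/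
structure IsBiproduct {W U V : D} (i₁ : U ⟶ W) (p₁ : W ⟶ U) (i₂ : V ⟶ W) (p₂ : W ⟶ V) :
    Prop where
  inl_fst : i₁ ≫ p₁ = 𝟙 U
  inr_snd : i₂ ≫ p₂ = 𝟙 V
  total : p₁ ≫ i₁ + p₂ ≫ i₂ = 𝟙 W

namespace IsBiproduct

variable {W U V : D} {i₁ : U ⟶ W} {p₁ : W ⟶ U} {i₂ : V ⟶ W} {p₂ : W ⟶ V}

lemma symm (h : IsBiproduct i₁ p₁ i₂ p₂) : IsBiproduct i₂ p₂ i₁ p₁ :=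
  ⟨h.inr_snd, h.inl_fst, by rw [add_comm, h.total]⟩

lemma inl_snd (h : IsBiproduct i₁ p₁ i₂ p₂) : i₁ ≫ p₂ = 0 := by
  have h₁ := i₁ ≫= h.total =≫ p₂
  simpa [reassoc_of% h.inl_fst, h.inr_snd] using h₁

lemma nonempty_isLimit (h : IsBiproduct i₁ p₁ i₂ p₂) :
    Nonempty (IsLimit (BinaryFan.mk p₁ p₂)) :=
  ⟨(isBinaryBilimitOfTotal
    (BinaryBicone.mk W p₁ p₂ i₁ i₂ h.inl_fst h.inl_snd h.symm.inl_snd h.inr_snd)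
    h.total).isLimit⟩

lemma exists_of_isLimit (h : IsLimit (BinaryFan.mk p₁ p₂)) :
    ∃ (i₁ : U ⟶ W) (i₂ : V ⟶ W), IsBiproduct i₁ p₁ i₂ p₂ := by
  obtain ⟨i₁, h₁₁, h₁₂⟩ := BinaryFan.IsLimit.lift' h (𝟙 U) (0 : U ⟶ V)
  obtain ⟨i₂, h₂₁, h₂₂⟩ := BinaryFan.IsLimit.lift' h (0 : V ⟶ U) (𝟙 V)
  dsimp at h₁₁ h₁₂ h₂₁ h₂₂
  refine ⟨i₁, i₂, h₁₁, h₂₂, BinaryFan.IsLimit.hom_ext h ?_ ?_⟩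
  · simp [h₁₁, h₂₁]
  · simp [h₁₂, h₂₂]

lemma nonempty_iso_left (h : IsBiproduct i₁ p₁ i₂ p₂) (hV : IsZero V) : Nonempty (W ≅ U) :=
  ⟨⟨p₁, i₁, by simpa [hV.eq_of_tgt p₂ 0] using h.total, h.inl_fst⟩⟩

lemma of_iso (h : IsBiproduct i₁ p₁ i₂ p₂) {W' U' V' : D} (e : W ≅ W') (a : U ≅ U')
    (b : V ≅ V') :
    IsBiproduct (a.inv ≫ i₁ ≫ e.hom) (e.inv ≫ p₁ ≫ a.hom) (b.inv ≫ i₂ ≫ e.hom)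
      (e.inv ≫ p₂ ≫ b.hom) where
  inl_fst := by simp [reassoc_of% h.inl_fst]
  inr_snd := by simp [reassoc_of% h.inr_snd]
  total := by
    have h₁ := e.inv ≫= h.total =≫ e.hom
    simpa using h₁

lemma map {E : Type*} [Category E] [Preadditive E] (F : D ⥤ E) [F.Additive]
    (h : IsBiproduct i₁ p₁ i₂ p₂) :
    IsBiproduct (F.map i₁) (F.map p₁) (F.map i₂) (F.map p₂) where
  inl_fst := by rw [← F.map_comp, h.inl_fst, F.map_id]
  inr_snd := by rw [← F.map_comp, h.inr_snd, F.map_id]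
  total := by rw [← F.map_comp, ← F.map_comp, ← F.map_add, h.total, F.map_id]

lemma of_map {E : Type*} [Category E] [Preadditive E] (F : D ⥤ E) [F.Additive] [F.Faithful]
    (h : IsBiproduct (F.map i₁) (F.map p₁) (F.map i₂) (F.map p₂)) :
    IsBiproduct i₁ p₁ i₂ p₂ where
  inl_fst := F.map_injective (by simpa using h.inl_fst)
  inr_snd := F.map_injective (by simpa using h.inr_snd)
  total := F.map_injective (by simpa using h.total)

end IsBiproduct

lemma indecomposable_iff {W : D} :
    Indecomposable W ↔ ¬ IsZero W ∧ ∀ (U V : D) (i₁ : U ⟶ W) (p₁ : W ⟶ U) (i₂ : V ⟶ W)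
      (p₂ : W ⟶ V), IsBiproduct i₁ p₁ i₂ p₂ → IsZero U ∨ IsZero V := by
  refine and_congr_right fun _ ↦ ⟨fun h U V i₁ p₁ i₂ p₂ hb ↦ h U V p₁ p₂ hb.nonempty_isLimit, ?_⟩
  rintro h U V p₁ p₂ ⟨hl⟩
  obtain ⟨i₁, i₂, hb⟩ := IsBiproduct.exists_of_isLimit hl
  exact h U V i₁ p₁ i₂ p₂ hb

lemma Indecomposable.of_iso {W W' : D} (h : Indecomposable W) (e : W ≅ W') :
    Indecomposable W' := by
  rw [indecomposable_iff] at h ⊢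
  exact ⟨fun h' ↦ h.1 (h'.of_iso e), fun U V _ _ _ _ hb ↦
    h.2 U V _ _ _ _ (hb.of_iso e.symm (Iso.refl U) (Iso.refl V))⟩

lemma Indecomposable.nonempty_iso_or {W U V : D} (h : Indecomposable W) {i₁ : U ⟶ W}
    {p₁ : W ⟶ U} {i₂ : V ⟶ W} {p₂ : W ⟶ V} (hb : IsBiproduct i₁ p₁ i₂ p₂) :
    Nonempty (W ≅ U) ∨ Nonempty (W ≅ V) :=
  ((indecomposable_iff.1 h).2 _ _ _ _ _ _ hb).symm.imp hb.nonempty_iso_left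
    hb.symm.nonempty_iso_left

lemma isZero_map_iff {E : Type*} [Category E] [Preadditive E] (F : D ⥤ E) [F.Additive]
    [F.Faithful] (X : D) : IsZero (F.obj X) ↔ IsZero X := by
  rw [IsZero.iff_id_eq_zero, IsZero.iff_id_eq_zero, ← F.map_id, F.map_eq_zero_iff]

/-- A fully faithful additive functor whose essential image is closed under retracts preserves
and reflects indecomposability. -/
lemma indecomposable_map_iff {E : Type*} [Category E] [Preadditive E] (F : D ⥤ E) [F.Additive]
    [F.Full] [F.Faithful]
    (hF : ∀ ⦃X : D⦄ ⦃U : E⦄ (i : U ⟶ F.obj X) (p : F.obj X ⟶ U), i ≫ p = 𝟙 U →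
      F.essImage U) (X : D) :
    Indecomposable (F.obj X) ↔ Indecomposable X := by
  rw [indecomposable_iff, indecomposable_iff, isZero_map_iff]
  refine and_congr_right fun _ ↦ ⟨fun h U V _ _ _ _ hb ↦ ?_, fun h U V i₁ p₁ i₂ p₂ hb ↦ ?_⟩
  · simpa only [isZero_map_iff] using h _ _ _ _ _ _ (hb.map F)
  · obtain ⟨U', ⟨a⟩⟩ := hF i₁ p₁ hb.inl_fst
    obtain ⟨V', ⟨b⟩⟩ := hF i₂ p₂ hb.inr_snd
    have hb' := hb.of_iso (Iso.refl _) a.symm b.symm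
    rw [← F.map_preimage (a.symm.inv ≫ i₁ ≫ _), ← F.map_preimage (_ ≫ p₁ ≫ a.symm.hom),
      ← F.map_preimage (b.symm.inv ≫ i₂ ≫ _), ← F.map_preimage (_ ≫ p₂ ≫ b.symm.hom)] at hb'
    rw [← a.isZero_iff, ← b.isZero_iff, isZero_map_iff, isZero_map_iff]
    exact h _ _ _ _ _ _ (hb'.of_map F)

end Biproducts

section Embeddings

variable (C)

/-- The functor `X ↦ (X →1 X)`. -/
@[simps]
def idArrow : C ⥤ Arrow C where
  obj X := Arrow.mk (𝟙 X)
  map f := Arrow.homMk f f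

/-- The functor `X ↦ (0 → X)`. -/
@[simps]
noncomputable def fromZeroArrow : C ⥤ Arrow C where
  obj X := Arrow.mk (0 : (0 : C) ⟶ X)
  map f := Arrow.homMk 0 f
  map_id _ := by ext <;> simp

/-- The functor `X ↦ (X → 0)`. -/
@[simps]
noncomputable def toZeroArrow : C ⥤ Arrow C where
  obj X := Arrow.mk (0 : X ⟶ (0 : C))
  map f := Arrow.homMk f 0
  map_id _ := by ext <;> simp

instance : (idArrow C).Additive where
instance : (fromZeroArrow C).Additive where
instance : (toZeroArrow C).Additive where

instance : (idArrow C).Faithful where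
  map_injective h := congrArg (fun φ ↦ φ.left) h

instance : (fromZeroArrow C).Faithful where
  map_injective h := congrArg (fun φ ↦ φ.right) h

instance : (toZeroArrow C).Faithful where
  map_injective h := congrArg (fun φ ↦ φ.left) h

instance : (idArrow C).Full where
  map_surjective φ := ⟨φ.left, Arrow.hom_ext _ _ rfl
    ((Category.comp_id _).symm.trans ((Arrow.w φ).trans (Category.id_comp _)))⟩

instance : (fromZeroArrow C).Full where
  map_surjective φ := ⟨φ.right, Arrow.hom_ext _ _ ((isZero_zero C).eq_of_src _ _) rfl⟩

instance : (toZeroArrow C).Full where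
  map_surjective φ := ⟨φ.left, Arrow.hom_ext _ _ rfl ((isZero_zero C).eq_of_tgt _ _)⟩

variable {C}

lemma indecomposable_id_iff (X : C) : Indecomposable (Arrow.mk (𝟙 X)) ↔ Indecomposable X := by
  refine indecomposable_map_iff (idArrow C) (fun Y U i p h ↦ ?_) X
  have hr : RetractArrow U.hom (𝟙 Y) := ⟨i, p, h⟩
  have : IsIso U.hom := (MorphismProperty.isomorphisms C).of_retract hr
    (inferInstanceAs (IsIso (𝟙 Y)))
  let e : U.left ≅ U.right := asIso U.hom
  exact ⟨U.left, ⟨Arrow.isoMk (Iso.refl _) e⟩⟩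

lemma indecomposable_fromZero_iff (X : C) :
    Indecomposable (Arrow.mk (0 : (0 : C) ⟶ X)) ↔ Indecomposable X := by
  refine indecomposable_map_iff (fromZeroArrow C) (fun Y U i p h ↦ ?_) X
  have hl : i.left ≫ p.left = 𝟙 _ := congrArg (fun φ ↦ φ.left) h
  have : Mono i.left := mono_of_mono_fac hl
  have hU : IsZero U.left := .of_mono i.left (isZero_zero C)
  exact ⟨U.right, ⟨Arrow.isoMk ((isZero_zero C).iso hU) (Iso.refl _)
    ((isZero_zero C).eq_of_src _ _)⟩⟩

lemma indecomposable_toZero_iff (X : C) :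
    Indecomposable (Arrow.mk (0 : X ⟶ (0 : C))) ↔ Indecomposable X := by
  refine indecomposable_map_iff (toZeroArrow C) (fun Y U i p h ↦ ?_) X
  have hr : i.right ≫ p.right = 𝟙 _ := congrArg (fun φ ↦ φ.right) h
  have : Mono i.right := mono_of_mono_fac hr
  have hU : IsZero U.right := .of_mono i.right (isZero_zero C)
  exact ⟨U.left, ⟨Arrow.isoMk (Iso.refl _) ((isZero_zero C).iso hU)
    (hU.eq_of_tgt _ _)⟩⟩

end Embeddings

section Projective

lemma IsCwProjective.of_iso {P Q : Arrow C} (h : IsCwProjective P) (e : P ≅ Q) :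
    IsCwProjective Q := by
  intro X Z Y ι π hπ t
  obtain ⟨l, hl⟩ := h ι π hπ (e.hom ≫ t)
  exact ⟨e.inv ≫ l, by simp [hl]⟩

lemma isCwProjective_id (X : C) : IsCwProjective (Arrow.mk (𝟙 X)) := by
  rintro A Z Y ι π ⟨⟨-, -, s, -, hs, -⟩, -⟩ t
  refine ⟨Arrow.homMk (t.left ≫ s) (t.left ≫ s ≫ Z.hom) (by simp), ?_⟩
  ext
  · simp [hs]
  · have w : Z.hom ≫ π.right = π.left ≫ Y.hom := (Arrow.w π).symm
    simp only [Arrow.comp_right, Arrow.homMk_right, Category.assoc, w, reassoc_of% hs]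
    exact (Arrow.w t).trans (Category.id_comp _)

lemma isCwProjective_fromZero (X : C) : IsCwProjective (Arrow.mk (0 : (0 : C) ⟶ X)) := by
  rintro A Z Y ι π ⟨-, ⟨-, -, s, -, hs, -⟩⟩ t
  refine ⟨Arrow.homMk (0 : (0 : C) ⟶ _) (t.right ≫ s) (by simp), ?_⟩
  ext
  · exact (isZero_zero C).eq_of_src _ _
  · simp [hs]

/-- An `E^cw`-projective arrow has a retraction: lift the identity along the canonical deflation
from `(X₁ →1 X₁) ⊕ (0 → X₂)`. -/
lemma IsCwProjective.exists_retraction {X₁ X₂ : C} {f : X₁ ⟶ X₂}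
    (h : IsCwProjective (Arrow.mk f)) : ∃ a : X₂ ⟶ X₁, f ≫ a = 𝟙 X₁ := by
  have := hasBinaryBiproducts_of_finite_biproducts C
  let Z : Arrow C := Arrow.mk (biprod.inl : X₁ ⟶ X₁ ⊞ X₂)
  let ι : Arrow.mk (0 : (0 : C) ⟶ X₁) ⟶ Z :=
    Arrow.homMk (0 : (0 : C) ⟶ X₁) (biprod.lift (𝟙 X₁) (-f)) (by simp)
  let π : Z ⟶ Arrow.mk f := Arrow.homMk (𝟙 X₁) (biprod.desc f (𝟙 X₂)) (by simp [Z])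
  have hπ : IsCwPair ι π := by
    refine ⟨⟨?_, 0, 𝟙 X₁, ?_, ?_, ?_⟩, ⟨?_, biprod.fst, biprod.inr, ?_, ?_, ?_⟩⟩
    · simp [ι]
    · exact (isZero_zero C).eq_of_src _ _
    · simp [π]
    · simp [π, Z]
    · simp [ι, π]
    · simp [ι]
    · simp [π]
    · have total : biprod.fst ≫ biprod.lift (𝟙 X₁) (-f) + biprod.desc f (𝟙 X₂) ≫ biprod.inr =
          𝟙 (X₁ ⊞ X₂) := by ext <;> simp
      exact total
  obtain ⟨l, hl⟩ := h ι π hπ (𝟙 _)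
  obtain ⟨u, v, hu, w⟩ : ∃ (u : X₁ ⟶ X₁) (v : X₂ ⟶ X₁ ⊞ X₂),
      u ≫ 𝟙 X₁ = 𝟙 X₁ ∧ u ≫ biprod.inl = f ≫ v :=
    ⟨l.left, l.right, congrArg (fun φ ↦ φ.left) hl, Arrow.w l⟩
  rw [Category.comp_id] at hu
  exact ⟨v ≫ biprod.fst, by simp [← reassoc_of% w, hu]⟩

/-- A split monomorphism decomposes as `(X₁ →1 X₁) ⊕ (0 → Y)`. -/
lemma nonempty_iso_of_retraction (hic : IsIdempotentComplete C) {X₁ X₂ : C} {f : X₁ ⟶ X₂}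
    {a : X₂ ⟶ X₁} (ha : f ≫ a = 𝟙 X₁) (hf : Indecomposable (Arrow.mk f)) :
    ∃ X : C, Nonempty (Arrow.mk f ≅ Arrow.mk (𝟙 X)) ∨
      Nonempty (Arrow.mk f ≅ Arrow.mk (0 : (0 : C) ⟶ X)) := by
  obtain ⟨Y, i, e, hie, hei⟩ := hic.idempotents_split X₂ (𝟙 X₂ - a ≫ f)
    (by simp [reassoc_of% ha])
  have hfe : f ≫ e = 0 := by
    have h : f ≫ e ≫ i ≫ e = 0 := by rw [reassoc_of% hei]; simp [reassoc_of% ha]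
    simpa [hie] using h
  have hb : IsBiproduct
      (Arrow.homMk (𝟙 X₁) f (by simp) : Arrow.mk (𝟙 X₁) ⟶ Arrow.mk f)
      (Arrow.homMk (𝟙 X₁) a (by simp [ha]))
      (Arrow.homMk (0 : (0 : C) ⟶ X₁) i (by simp) : Arrow.mk (0 : (0 : C) ⟶ Y) ⟶ Arrow.mk f)
      (Arrow.homMk (0 : X₁ ⟶ (0 : C)) e (by simp [hfe])) := by
    refine ⟨?_, ?_, ?_⟩ <;> ext
    · simp
    · simp [ha]
    · exact (isZero_zero C).eq_of_src _ _
    · simp [hie]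
    · simp
    · simp [hei]
  rcases hf.nonempty_iso_or hb with h | h
  exacts [⟨X₁, .inl h⟩, ⟨Y, .inr h⟩]

end Projective

section Injective

lemma IsCwInjective.of_iso {I J : Arrow C} (h : IsCwInjective I) (e : I ≅ J) :
    IsCwInjective J := by
  intro X Z Y ι π hπ t
  obtain ⟨l, hl⟩ := h ι π hπ (t ≫ e.inv)
  exact ⟨l ≫ e.hom, by simp [reassoc_of% hl]⟩

lemma isCwInjective_id (X : C) : IsCwInjective (Arrow.mk (𝟙 X)) := by
  rintro A Z Y ι π ⟨-, ⟨-, r, -, hr, -, -⟩⟩ t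
  refine ⟨Arrow.homMk (Z.hom ≫ r ≫ t.right) (r ≫ t.right) (by simp), ?_⟩
  have wt : t.left = A.hom ≫ t.right := (Category.comp_id _).symm.trans (Arrow.w t)
  ext
  · simp [reassoc_of% hr, wt]
  · simp [reassoc_of% hr]

lemma isCwInjective_toZero (X : C) : IsCwInjective (Arrow.mk (0 : X ⟶ (0 : C))) := by
  rintro A Z Y ι π ⟨⟨-, r, -, hr, -, -⟩, -⟩ t
  refine ⟨Arrow.homMk (r ≫ t.left) (0 : _ ⟶ (0 : C)) (by simp), ?_⟩
  ext
  · simp [reassoc_of% hr]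
  · exact (isZero_zero C).eq_of_tgt _ _

/-- An `E^cw`-injective arrow has a section: extend the identity along the canonical inflation
into `(X₂ →1 X₂) ⊕ (X₁ → 0)`. -/
lemma IsCwInjective.exists_section {X₁ X₂ : C} {f : X₁ ⟶ X₂}
    (h : IsCwInjective (Arrow.mk f)) : ∃ a : X₂ ⟶ X₁, a ≫ f = 𝟙 X₂ := by
  have := hasBinaryBiproducts_of_finite_biproducts C
  let Z : Arrow C := Arrow.mk (biprod.fst : X₂ ⊞ X₁ ⟶ X₂)
  let ι : Arrow.mk f ⟶ Z := Arrow.homMk (biprod.lift f (𝟙 X₁)) (𝟙 X₂) (by simp [Z])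
  let π : Z ⟶ Arrow.mk (0 : X₂ ⟶ (0 : C)) :=
    Arrow.homMk (biprod.desc (𝟙 X₂) (-f)) (0 : X₂ ⟶ (0 : C)) (by simp)
  have hπ : IsCwPair ι π := by
    refine ⟨⟨?_, biprod.snd, biprod.inl, ?_, ?_, ?_⟩, ⟨?_, 𝟙 X₂, 0, ?_, ?_, ?_⟩⟩
    · simp [ι, π]
    · simp [ι]
    · simp [π]
    · have total : biprod.snd ≫ biprod.lift f (𝟙 X₁) + biprod.desc (𝟙 X₂) (-f) ≫ biprod.inl =
          𝟙 (X₂ ⊞ X₁) := by ext <;> simp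
      exact total
    · simp [π]
    · simp [ι]
    · exact (isZero_zero C).eq_of_src _ _
    · simp [ι, Z]
  obtain ⟨l, hl⟩ := h ι π hπ (𝟙 _)
  obtain ⟨u, v, hv, w⟩ : ∃ (u : X₂ ⊞ X₁ ⟶ X₁) (v : X₂ ⟶ X₂),
      𝟙 X₂ ≫ v = 𝟙 X₂ ∧ u ≫ f = biprod.fst ≫ v :=
    ⟨l.left, l.right, congrArg (fun φ ↦ φ.right) hl, Arrow.w l⟩
  rw [Category.id_comp] at hv
  exact ⟨biprod.inl ≫ u, by simp [w, hv]⟩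

/-- A split epimorphism decomposes as `(X₂ →1 X₂) ⊕ (Y → 0)`. -/
lemma nonempty_iso_of_section (hic : IsIdempotentComplete C) {X₁ X₂ : C} {f : X₁ ⟶ X₂}
    {a : X₂ ⟶ X₁} (ha : a ≫ f = 𝟙 X₂) (hf : Indecomposable (Arrow.mk f)) :
    ∃ X : C, Nonempty (Arrow.mk f ≅ Arrow.mk (𝟙 X)) ∨
      Nonempty (Arrow.mk f ≅ Arrow.mk (0 : X ⟶ (0 : C))) := by
  obtain ⟨Y, i, e, hie, hei⟩ := hic.idempotents_split X₁ (𝟙 X₁ - f ≫ a)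
    (by simp [reassoc_of% ha])
  have hif : i ≫ f = 0 := by
    have h : i ≫ (e ≫ i) ≫ f = 0 := by rw [hei]; simp [ha]
    simpa [reassoc_of% hie] using h
  have hb : IsBiproduct
      (Arrow.homMk a (𝟙 X₂) (by simp [ha]) : Arrow.mk (𝟙 X₂) ⟶ Arrow.mk f)
      (Arrow.homMk f (𝟙 X₂) (by simp))
      (Arrow.homMk i (0 : (0 : C) ⟶ X₂) (by simp [hif]) :
        Arrow.mk (0 : Y ⟶ (0 : C)) ⟶ Arrow.mk f)
      (Arrow.homMk e (0 : X₂ ⟶ (0 : C)) (by simp)) := by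
    refine ⟨?_, ?_, ?_⟩ <;> ext
    · simp [ha]
    · simp
    · simp [hie]
    · exact (isZero_zero C).eq_of_src _ _
    · simp [hei]
    · simp
  rcases hf.nonempty_iso_or hb with h | h
  exacts [⟨X₂, .inl h⟩, ⟨Y, .inr h⟩]

end Injective

theorem statement1 (hic : IsIdempotentComplete C) (hpk : HasPseudokernels C)
    {X₁ X₂ : C} (f : X₁ ⟶ X₂) :
    ((Indecomposable (Arrow.mk f) ∧ IsCwProjective (Arrow.mk f)) ↔
      ∃ X : C, Indecomposable X ∧
        (Nonempty (Arrow.mk f ≅ Arrow.mk (𝟙 X)) ∨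
          Nonempty (Arrow.mk f ≅ Arrow.mk (0 : (0 : C) ⟶ X)))) ∧
    ((Indecomposable (Arrow.mk f) ∧ IsCwInjective (Arrow.mk f)) ↔
      ∃ X : C, Indecomposable X ∧
        (Nonempty (Arrow.mk f ≅ Arrow.mk (𝟙 X)) ∨
          Nonempty (Arrow.mk f ≅ Arrow.mk (0 : X ⟶ (0 : C))))) := by
  refine ⟨⟨?_, ?_⟩, ⟨?_, ?_⟩⟩
  · rintro ⟨hf, hp⟩
    obtain ⟨a, ha⟩ := hp.exists_retraction
    obtain ⟨X, ⟨⟨e⟩⟩ | ⟨⟨e⟩⟩⟩ := nonempty_iso_of_retraction hic ha hf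
    · exact ⟨X, (indecomposable_id_iff X).1 (hf.of_iso e), .inl ⟨e⟩⟩
    · exact ⟨X, (indecomposable_fromZero_iff X).1 (hf.of_iso e), .inr ⟨e⟩⟩
  · rintro ⟨X, hX, ⟨⟨e⟩⟩ | ⟨⟨e⟩⟩⟩
    · exact ⟨((indecomposable_id_iff X).2 hX).of_iso e.symm, (isCwProjective_id X).of_iso e.symm⟩
    · exact ⟨((indecomposable_fromZero_iff X).2 hX).of_iso e.symm,
        (isCwProjective_fromZero X).of_iso e.symm⟩
  · rintro ⟨hf, hi⟩
    obtain ⟨a, ha⟩ := hi.exists_section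
    obtain ⟨X, ⟨⟨e⟩⟩ | ⟨⟨e⟩⟩⟩ := nonempty_iso_of_section hic ha hf
    · exact ⟨X, (indecomposable_id_iff X).1 (hf.of_iso e), .inl ⟨e⟩⟩
    · exact ⟨X, (indecomposable_toZero_iff X).1 (hf.of_iso e), .inr ⟨e⟩⟩
  · rintro ⟨X, hX, ⟨⟨e⟩⟩ | ⟨⟨e⟩⟩⟩
    · exact ⟨((indecomposable_id_iff X).2 hX).of_iso e.symm, (isCwInjective_id X).of_iso e.symm⟩
    · exact ⟨((indecomposable_toZero_iff X).2 hX).of_iso e.symm,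
        (isCwInjective_toZero X).of_iso e.symm⟩

end Statement1
end

section
/- Let Λ be an Artin algebra and X a full additive subcategory of mod-Λ closed under direct summands, closed under extensions, and functorially finite in mod-Λ. Let 0 → (X1 →f X2) →(φ1,φ2) (Z1 →h Z2) →(ψ1,ψ2) (Y1 →g Y2) → 0 be an almost split sequence in H(X). If either (1) the end term (Y1 →g Y2) is not isomorphic to any object of the form (0 → Y) or (Y →1 Y), or (2) the initial term (X1 →f X2) is not isomorphic to any object of the form (M →1 M) or (M → 0), then for i = 1, 2 the short exact sequences 0 → Xi →φi Zi →ψi Yi → 0 of Λ-modules split. -/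
/-!
STATEMENT 8: Let Λ be an Artin algebra, X a full additive subcategory of mod-Λ closed
under direct summands and extensions and functorially finite, and let
0 → (X1 →f X2) →(φ1,φ2) (Z1 →h Z2) →(ψ1,ψ2) (Y1 →g Y2) → 0 be an almost split
sequence in H(X).  If the end term is not of the form (0 → Y) or (Y →1 Y), or the
initial term is not of the form (M →1 M) or (M → 0), then both component short exact
sequences of Λ-modules split.
-/

open CategoryTheory CategoryTheory.Limits

namespace Statement8

variable (k : Type) [CommRing k] [IsArtinianRing k]
variable (Λ : Type) [Ring Λ] [Algebra k Λ] [Module.Finite k Λ]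
variable (𝒳 : ModuleCat.{0} Λ → Prop)

/-- Short exact sequence of Λ-modules. -/
def IsSES {A B X : ModuleCat.{0} Λ} (i : A ⟶ B) (p : B ⟶ X) : Prop :=
  Function.Injective i ∧ Function.Surjective p ∧ Function.Exact i p

/-- Objects of H(X). -/
def InHX (W : Arrow (ModuleCat.{0} Λ)) : Prop := 𝒳 W.left ∧ 𝒳 W.right

/-- Short exact sequence in H(X). -/
def IsSESinHX {X Z Y : Arrow (ModuleCat.{0} Λ)} (ι : X ⟶ Z) (π : Z ⟶ Y) : Prop :=
  InHX Λ 𝒳 X ∧ InHX Λ 𝒳 Z ∧ InHX Λ 𝒳 Y ∧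
    IsSES Λ ι.left π.left ∧ IsSES Λ ι.right π.right

/-- An almost split sequence in H(X). -/
def IsAlmostSplitHX {X Z Y : Arrow (ModuleCat.{0} Λ)} (ι : X ⟶ Z) (π : Z ⟶ Y) : Prop :=
  IsSESinHX Λ 𝒳 ι π ∧ ¬ IsSplitMono ι ∧ ¬ IsSplitEpi π ∧
  (∀ (W : Arrow (ModuleCat.{0} Λ)), InHX Λ 𝒳 W →
    ∀ t : W ⟶ Y, ¬ IsSplitEpi t → ∃ l : W ⟶ Z, l ≫ π = t) ∧
  (∀ (W : Arrow (ModuleCat.{0} Λ)), InHX Λ 𝒳 W →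
    ∀ t : X ⟶ W, ¬ IsSplitMono t → ∃ l : Z ⟶ W, ι ≫ l = t)

/-- The arrow `W` is isomorphic to an object of type (a), i.e. of the form (0 → Y). -/
def IsTypeA (W : Arrow (ModuleCat.{0} Λ)) : Prop :=
  ∃ (Z Y : ModuleCat.{0} Λ) (f : Z ⟶ Y), IsZero Z ∧ Nonempty (W ≅ Arrow.mk f)

/-- The arrow `W` is isomorphic to an object of type (b), i.e. of the form (Y →1 Y). -/
def IsTypeB (W : Arrow (ModuleCat.{0} Λ)) : Prop :=
  ∃ Y : ModuleCat.{0} Λ, Nonempty (W ≅ Arrow.mk (𝟙 Y))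

/-- The arrow `W` is isomorphic to an object of type (c), i.e. of the form (M → 0). -/
def IsTypeC (W : Arrow (ModuleCat.{0} Λ)) : Prop :=
  ∃ (M Z : ModuleCat.{0} Λ) (f : M ⟶ Z), IsZero Z ∧ Nonempty (W ≅ Arrow.mk f)

theorem IsSES.isSplitMono_iff_isSplitEpi {Λ : Type} [Ring Λ] {A B X : ModuleCat.{0} Λ}
    {i : A ⟶ B} {p : B ⟶ X} (hip : IsSES Λ i p) : IsSplitMono i ↔ IsSplitEpi p := by
  obtain ⟨hi, hp, he⟩ := hip
  have he' : Function.Exact i.hom p.hom := he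
  have key := (he'.split_tfae hi hp).out 0 1
  constructor
  · rintro ⟨⟨r, hr⟩⟩
    obtain ⟨l, hl⟩ := key.2 ⟨r.hom, by rw [← ModuleCat.hom_comp, hr, ModuleCat.hom_id]⟩
    exact ⟨⟨ModuleCat.ofHom l, ModuleCat.hom_ext hl⟩⟩
  · rintro ⟨⟨s, hs⟩⟩
    obtain ⟨l, hl⟩ := key.1 ⟨s.hom, by rw [← ModuleCat.hom_comp, hs, ModuleCat.hom_id]⟩
    exact ⟨⟨ModuleCat.ofHom l, ModuleCat.hom_ext hl⟩⟩

/-- An arrow which is an isomorphism is isomorphic to an identity arrow. -/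
theorem isTypeB_of_inverse {Λ : Type} [Ring Λ] {A B : ModuleCat.{0} Λ} (f : A ⟶ B) (s : B ⟶ A)
    (hfs : f ≫ s = 𝟙 A) (hsf : s ≫ f = 𝟙 B) : IsTypeB Λ (Arrow.mk f) :=
  ⟨B, ⟨Arrow.isoMk ⟨f, s, hfs, hsf⟩ (Iso.refl B)⟩⟩

theorem isTypeA_of_isZero {Λ : Type} [Ring Λ] {A B : ModuleCat.{0} Λ} (f : A ⟶ B)
    (hA : IsZero A) : IsTypeA Λ (Arrow.mk f) :=
  ⟨A, B, f, hA, ⟨Iso.refl _⟩⟩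

theorem isTypeC_of_isZero {Λ : Type} [Ring Λ] {A B : ModuleCat.{0} Λ} (f : A ⟶ B)
    (hB : IsZero B) : IsTypeC Λ (Arrow.mk f) :=
  ⟨A, B, f, hB, ⟨Iso.refl _⟩⟩

/-- If every morphism in `H(X)` to `g` that is not a split epimorphism lifts along `π` and `g` is neither of the
form `0 → Y` nor an identity, then both components of `π` are split epimorphisms. -/
theorem isSplitEpi_components {Λ : Type} [Ring Λ] {𝒳 : ModuleCat.{0} Λ → Prop}
    (hzero : ∃ Z : ModuleCat.{0} Λ, IsZero Z ∧ 𝒳 Z)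
    {Z : Arrow (ModuleCat.{0} Λ)} {Y₁ Y₂ : ModuleCat.{0} Λ} (g : Y₁ ⟶ Y₂) (π : Z ⟶ Arrow.mk g)
    (hY : InHX Λ 𝒳 (Arrow.mk g))
    (hlift : ∀ (W : Arrow (ModuleCat.{0} Λ)), InHX Λ 𝒳 W →
      ∀ t : W ⟶ Arrow.mk g, ¬ IsSplitEpi t → ∃ l : W ⟶ Z, l ≫ π = t)
    (hA : ¬ IsTypeA Λ (Arrow.mk g)) (hB : ¬ IsTypeB Λ (Arrow.mk g)) :
    IsSplitEpi π.left ∧ IsSplitEpi π.right := by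
  constructor
  · let t : Arrow.mk (𝟙 Y₁) ⟶ Arrow.mk g := Arrow.homMk (𝟙 Y₁) g
    obtain ⟨l, hl⟩ := hlift (Arrow.mk (𝟙 Y₁)) ⟨hY.1, hY.1⟩ t (by
      rintro ⟨⟨s, hs⟩⟩
      have h₁ : s.left ≫ 𝟙 Y₁ = 𝟙 Y₁ := congrArg (fun q => q.left) hs
      have h₂ : s.right ≫ g = 𝟙 Y₂ := congrArg (fun q => q.right) hs
      have hw : s.left ≫ 𝟙 Y₁ = g ≫ s.right := s.w
      exact hB (isTypeB_of_inverse g s.right (hw.symm.trans h₁) h₂))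
    exact ⟨⟨l.left, congrArg (fun q => q.left) hl⟩⟩
  · obtain ⟨O, hO, hO𝒳⟩ := hzero
    let t : Arrow.mk (hO.to_ Y₂) ⟶ Arrow.mk g :=
      Arrow.homMk (hO.to_ Y₁) (𝟙 Y₂) (hO.eq_of_src _ _)
    obtain ⟨l, hl⟩ := hlift (Arrow.mk (hO.to_ Y₂)) ⟨hO𝒳, hY.2⟩ t (by
      rintro ⟨⟨s, hs⟩⟩
      have h₁ : s.left ≫ hO.to_ Y₁ = 𝟙 Y₁ := congrArg (fun q => q.left) hs
      have hO' : hO.to_ Y₁ = 0 := hO.eq_of_src _ _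
      refine hA (isTypeA_of_isZero g ((IsZero.iff_id_eq_zero _).2 ?_))
      rw [← h₁, hO', comp_zero])
    exact ⟨⟨l.right, congrArg (fun q => q.right) hl⟩⟩

/-- If every morphism in `H(X)` out of `f` that is not a split monomorphism extends along `ι` and `f` is neither of
the form `M → 0` nor an identity, then both components of `ι` are split monomorphisms. -/
theorem isSplitMono_components {Λ : Type} [Ring Λ] {𝒳 : ModuleCat.{0} Λ → Prop}
    (hzero : ∃ Z : ModuleCat.{0} Λ, IsZero Z ∧ 𝒳 Z)
    {Z : Arrow (ModuleCat.{0} Λ)} {X₁ X₂ : ModuleCat.{0} Λ} (f : X₁ ⟶ X₂) (ι : Arrow.mk f ⟶ Z)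
    (hX : InHX Λ 𝒳 (Arrow.mk f))
    (hextend : ∀ (W : Arrow (ModuleCat.{0} Λ)), InHX Λ 𝒳 W →
      ∀ t : Arrow.mk f ⟶ W, ¬ IsSplitMono t → ∃ l : Z ⟶ W, ι ≫ l = t)
    (hB : ¬ IsTypeB Λ (Arrow.mk f)) (hC : ¬ IsTypeC Λ (Arrow.mk f)) :
    IsSplitMono ι.left ∧ IsSplitMono ι.right := by
  constructor
  · obtain ⟨O, hO, hO𝒳⟩ := hzero
    let t : Arrow.mk f ⟶ Arrow.mk (hO.from_ X₁) :=
      Arrow.homMk (𝟙 X₁) (hO.from_ X₂) (hO.eq_of_tgt _ _)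
    obtain ⟨l, hl⟩ := hextend (Arrow.mk (hO.from_ X₁)) ⟨hX.1, hO𝒳⟩ t (by
      rintro ⟨⟨r, hr⟩⟩
      have h₂ : hO.from_ X₂ ≫ r.right = 𝟙 X₂ := congrArg (fun q => q.right) hr
      have hO' : hO.from_ X₂ = 0 := hO.eq_of_tgt _ _
      refine hC (isTypeC_of_isZero f ((IsZero.iff_id_eq_zero _).2 ?_))
      rw [← h₂, hO', zero_comp])
    exact ⟨⟨l.left, congrArg (fun q => q.left) hl⟩⟩
  · let t : Arrow.mk f ⟶ Arrow.mk (𝟙 X₂) := Arrow.homMk f (𝟙 X₂)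
    obtain ⟨l, hl⟩ := hextend (Arrow.mk (𝟙 X₂)) ⟨hX.2, hX.2⟩ t (by
      rintro ⟨⟨r, hr⟩⟩
      have h₁ : f ≫ r.left = 𝟙 X₁ := congrArg (fun q => q.left) hr
      have h₂ : 𝟙 X₂ ≫ r.right = 𝟙 X₂ := congrArg (fun q => q.right) hr
      have hw : r.left ≫ f = 𝟙 X₂ ≫ r.right := r.w
      exact hB (isTypeB_of_inverse f r.left h₁ (hw.trans h₂)))
    exact ⟨⟨l.right, congrArg (fun q => q.right) hl⟩⟩

theorem statement8
    (hfg : ∀ M : ModuleCat.{0} Λ, 𝒳 M → Module.Finite Λ M)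
    (hzero : ∃ Z : ModuleCat.{0} Λ, IsZero Z ∧ 𝒳 Z)
    (hsum : ∀ M N : ModuleCat.{0} Λ, 𝒳 M → 𝒳 N → 𝒳 (M ⊞ N))
    (hsummand : ∀ (M N : ModuleCat.{0} Λ) (s : N ⟶ M) (r : M ⟶ N),
      s ≫ r = 𝟙 N → 𝒳 M → 𝒳 N)
    (hext : ∀ (A B X : ModuleCat.{0} Λ) (i : A ⟶ B) (p : B ⟶ X),
      IsSES Λ i p → 𝒳 A → 𝒳 X → 𝒳 B)
    (hrapp : ∀ M : ModuleCat.{0} Λ, Module.Finite Λ M →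
      ∃ (X₀ : ModuleCat.{0} Λ), 𝒳 X₀ ∧ ∃ u : X₀ ⟶ M,
        ∀ (X' : ModuleCat.{0} Λ), 𝒳 X' → ∀ t : X' ⟶ M, ∃ s : X' ⟶ X₀, s ≫ u = t)
    (hlapp : ∀ M : ModuleCat.{0} Λ, Module.Finite Λ M →
      ∃ (X₀ : ModuleCat.{0} Λ), 𝒳 X₀ ∧ ∃ u : M ⟶ X₀,
        ∀ (X' : ModuleCat.{0} Λ), 𝒳 X' → ∀ t : M ⟶ X', ∃ s : X₀ ⟶ X', u ≫ s = t)
    -- the almost split sequence in H(X)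
    {X₁ X₂ Z₁ Z₂ Y₁ Y₂ : ModuleCat.{0} Λ}
    (f : X₁ ⟶ X₂) (h : Z₁ ⟶ Z₂) (g : Y₁ ⟶ Y₂)
    (ι : Arrow.mk f ⟶ Arrow.mk h) (π : Arrow.mk h ⟶ Arrow.mk g)
    (has : IsAlmostSplitHX Λ 𝒳 ι π)
    -- condition (1) or condition (2)
    (hcond : (¬ IsTypeA Λ (Arrow.mk g) ∧ ¬ IsTypeB Λ (Arrow.mk g)) ∨
             (¬ IsTypeB Λ (Arrow.mk f) ∧ ¬ IsTypeC Λ (Arrow.mk f))) :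
    -- the component short exact sequences split
    IsSplitMono ι.left ∧ IsSplitEpi π.left ∧ IsSplitMono ι.right ∧ IsSplitEpi π.right := by
  obtain ⟨⟨hX, -, hY, hleft, hright⟩, -, -, hlift, hextend⟩ := has
  rcases hcond with ⟨hA, hB⟩ | ⟨hB, hC⟩
  · obtain ⟨h₁, h₂⟩ := isSplitEpi_components hzero g π hY hlift hA hB
    exact ⟨hleft.isSplitMono_iff_isSplitEpi.2 h₁, h₁,
      hright.isSplitMono_iff_isSplitEpi.2 h₂, h₂⟩
  · obtain ⟨h₁, h₂⟩ := isSplitMono_components hzero f ι hX hextend hB hC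
    exact ⟨h₁, hleft.isSplitMono_iff_isSplitEpi.1 h₁,
      h₂, hright.isSplitMono_iff_isSplitEpi.1 h₂⟩

end Statement8
end

section
/- Let Λ be an Artin algebra over the commutative artinian ring k, with duality D = Hom_k(−,E). Let M be an indecomposable non-projective finitely generated Λ-module with minimal projective presentation P →f Q →g M → 0, and let 0 → T → B → M → 0 be an almost split sequence in mod-Λ (so T = τ(M)). Then there exists a natural monomorphism of functors Hom_Λ(−,T) → D∘Hom_Λ(P,−) on mod-Λ such that for every finitely generated Λ-module N the sequence 0 → Hom_Λ(N,T) → D(Hom_Λ(P,N)) → D(Hom_Λ(Q,N)) → D(Hom_Λ(M,N)) → 0 is exact, where the second and third maps are D applied to composition with f and with g respectively. -/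
/-!
STATEMENT 12: Let Λ be an Artin algebra over a commutative artinian ring k, with
duality D = Hom_k(−,E), M an indecomposable non-projective finitely generated
Λ-module with minimal projective presentation P →f Q →g M → 0 and almost split
sequence 0 → T → B → M → 0 (so T = τ(M)).  Then there is a natural monomorphism of
functors Hom_Λ(−,T) → D∘Hom_Λ(P,−) on mod-Λ such that for every finitely generated
Λ-module N the sequence
  0 → Hom_Λ(N,T) → D(Hom_Λ(P,N)) → D(Hom_Λ(Q,N)) → D(Hom_Λ(M,N)) → 0
is exact, the second and third maps being D applied to composition with f, g.
-/

open Function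

namespace Statement12

variable (k : Type) [CommRing k] (Λ : Type) [Ring Λ] [Algebra k Λ]

/-- An indecomposable module: nontrivial, and having no nontrivial direct sum
decomposition. -/
def IndecMod (V : Type) [AddCommGroup V] [Module Λ V] : Prop :=
  Nontrivial V ∧ ∀ N₁ N₂ : Submodule Λ V, IsCompl N₁ N₂ → N₁ = ⊥ ∨ N₂ = ⊥

/-- `(i, p)` is an almost split sequence of finitely generated Λ-modules. -/
def IsAlmostSplitSeq {T B C : Type} [AddCommGroup T] [Module Λ T]
    [AddCommGroup B] [Module Λ B] [AddCommGroup C] [Module Λ C]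
    (i : T →ₗ[Λ] B) (p : B →ₗ[Λ] C) : Prop :=
  (Function.Injective i ∧ Function.Surjective p ∧ Function.Exact i p) ∧
  ¬ (∃ r : B →ₗ[Λ] T, r ∘ₗ i = LinearMap.id) ∧
  ¬ (∃ s : C →ₗ[Λ] B, p ∘ₗ s = LinearMap.id) ∧
  (∀ (Z : Type) [AddCommGroup Z] [Module Λ Z] [Module.Finite Λ Z],
    ∀ t : Z →ₗ[Λ] C, ¬ (∃ s : C →ₗ[Λ] Z, t ∘ₗ s = LinearMap.id) →
      ∃ l : Z →ₗ[Λ] B, p ∘ₗ l = t) ∧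
  (∀ (Z : Type) [AddCommGroup Z] [Module Λ Z] [Module.Finite Λ Z],
    ∀ t : T →ₗ[Λ] Z, ¬ (∃ r : Z →ₗ[Λ] T, r ∘ₗ t = LinearMap.id) →
      ∃ l : B →ₗ[Λ] Z, l ∘ₗ i = t)

/-- Precomposition with a Λ-linear map, as a k-linear map of Hom-modules. -/
def pre {V W : Type} [AddCommGroup V] [Module Λ V] [AddCommGroup W] [Module Λ W]
    (f : V →ₗ[Λ] W) (N : Type) [AddCommGroup N] [Module k N] [Module Λ N]
    [SMulCommClass Λ k N] :
    (W →ₗ[Λ] N) →ₗ[k] (V →ₗ[Λ] N) where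
  toFun u := u.comp f
  map_add' _ _ := LinearMap.add_comp _ _ _
  map_smul' c u := LinearMap.smul_comp c u f

section Duality

variable {k : Type} [CommRing k] {E : Type} [AddCommGroup E] [Module k E]

/-- A functional with values in an injective module factors through every linear map whose
kernel it annihilates. -/
theorem exists_comp_eq_of_ker_le (hE : Module.Injective k E)
    {X Y : Type} [AddCommGroup X] [Module k X] [AddCommGroup Y] [Module k Y]
    (b : X →ₗ[k] Y) (ψ : X →ₗ[k] E) (h : LinearMap.ker b ≤ LinearMap.ker ψ) :
    ∃ χ : Y →ₗ[k] E, χ ∘ₗ b = ψ := by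
  have hinj : Function.Injective ((LinearMap.ker b).liftQ b le_rfl) :=
    LinearMap.ker_eq_bot.mp (Submodule.ker_liftQ_eq_bot _ _ _ le_rfl)
  obtain ⟨χ, hχ⟩ := hE.out _ hinj ((LinearMap.ker b).liftQ ψ h)
  exact ⟨χ, LinearMap.ext fun x => by simpa using hχ (Submodule.Quotient.mk x)⟩

/-- An injective module containing `k / rad k` is a cogenerator. -/
theorem exists_apply_ne_zero [IsArtinianRing k] (hE : Module.Injective k E)
    (φ : (k ⧸ Ideal.jacobson (⊥ : Ideal k)) →ₗ[k] E) (hφ : Function.Injective φ)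
    {X : Type} [AddCommGroup X] [Module k X] {x : X} (hx : x ≠ 0) :
    ∃ ψ : X →ₗ[k] E, ψ x ≠ 0 := by
  classical
  have hne : LinearMap.ker (LinearMap.toSpanSingleton k X x) ≠ ⊤ := fun h => hx <| by
    have : (1 : k) ∈ LinearMap.ker (LinearMap.toSpanSingleton k X x) := h ▸ Submodule.mem_top
    simpa using this
  obtain ⟨m, hm, hle⟩ := Ideal.exists_le_maximal _ hne
  have hrad : Ideal.jacobson (⊥ : Ideal k) = nilradical k := IsArtinianRing.jacobson_eq_radical ⊥
  let z : ∀ I : MaximalSpectrum k, k ⧸ I.asIdeal := Pi.single ⟨m, hm⟩ 1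
  have hz0 : z ≠ 0 := by
    have : Nontrivial (k ⧸ m) := Ideal.Quotient.nontrivial_iff.mpr hm.ne_top
    exact Pi.single_ne_zero_iff.mpr one_ne_zero
  have hzm : ∀ a ∈ m, a • z = 0 := by
    intro a ha
    simp only [z, ← Pi.single_smul, Pi.single_eq_zero_iff]
    exact (Algebra.smul_def a _).trans
      ((mul_one _).trans (Ideal.Quotient.eq_zero_iff_mem.mpr ha))
  obtain ⟨b, hb⟩ := Ideal.Quotient.mk_surjective ((IsArtinianRing.quotNilradicalEquivPi k).symm z)
  have hb0 : b ∉ nilradical k := fun h => hz0 <| by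
    rw [← Ideal.Quotient.eq_zero_iff_mem, hb] at h
    simpa using h
  have hbm : ∀ a ∈ m, a * b ∈ nilradical k := by
    intro a ha
    rw [← Ideal.Quotient.eq_zero_iff_mem, map_mul, hb]
    have := congrArg (IsArtinianRing.quotNilradicalEquivPi k).symm (hzm a ha)
    rw [map_smul, map_zero, Algebra.smul_def] at this
    exact this
  rw [← hrad] at hb0 hbm
  obtain ⟨ψ, hψ⟩ := exists_comp_eq_of_ker_le hE (LinearMap.toSpanSingleton k X x)
    (LinearMap.toSpanSingleton k E (φ (Ideal.Quotient.mk _ b))) fun a ha => by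
      rw [LinearMap.mem_ker, LinearMap.toSpanSingleton_apply, ← map_smul]
      have : a • (Ideal.Quotient.mk (Ideal.jacobson (⊥ : Ideal k)) b) = 0 :=
        Ideal.Quotient.eq_zero_iff_mem.mpr (hbm a (hle ha))
      rw [this, map_zero]
  refine ⟨ψ, fun h => hb0 ?_⟩
  have h1 := LinearMap.congr_fun hψ 1
  simp only [LinearMap.comp_apply, LinearMap.toSpanSingleton_apply, one_smul, h] at h1
  rw [← Ideal.Quotient.eq_zero_iff_mem]
  exact hφ (h1.symm.trans (map_zero φ).symm)

/-- If the image of `k / rad k` is essential in `E`, the dual of a simple module is cyclic on each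
of its nonzero elements. -/
theorem exists_smul_eq_of_isSimpleModule
    (φ : (k ⧸ Ideal.jacobson (⊥ : Ideal k)) →ₗ[k] E) (hφ : Function.Injective φ)
    (hess : ∀ N : Submodule k E, N ≠ ⊥ → N ⊓ LinearMap.range φ ≠ ⊥)
    {S : Type} [AddCommGroup S] [Module k S] [IsSimpleModule k S]
    {ψ₁ : S →ₗ[k] E} (h₁ : ψ₁ ≠ 0) (ψ₂ : S →ₗ[k] E) : ∃ c : k, c • ψ₁ = ψ₂ := by
  have hrange : ∀ ψ : S →ₗ[k] E, ∀ s : S, ψ s ∈ LinearMap.range φ := by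
    intro ψ s
    by_cases hψ : ψ = 0
    · simp [hψ]
    have hne := hess (LinearMap.range ψ) (by rwa [Ne, LinearMap.range_eq_bot])
    rcases eq_bot_or_eq_top ((LinearMap.range φ).comap ψ) with h | h
    · refine absurd (eq_bot_iff.mpr ?_) hne
      rintro _ ⟨⟨s, rfl⟩, hs⟩
      have : s ∈ (LinearMap.range φ).comap ψ := hs
      rw [h, Submodule.mem_bot] at this
      simp [this]
    · have : s ∈ (LinearMap.range φ).comap ψ := h ▸ Submodule.mem_top
      exact this
  obtain ⟨s, hs⟩ : ∃ s, ψ₁ s ≠ 0 := by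
    by_contra! h
    exact h₁ (LinearMap.ext h)
  have hs0 : s ≠ 0 := fun h => hs (by simp [h])
  obtain ⟨y₁, hy₁⟩ := hrange ψ₁ s
  obtain ⟨y₂, hy₂⟩ := hrange ψ₂ s
  obtain ⟨b₁, rfl⟩ := Ideal.Quotient.mk_surjective y₁
  obtain ⟨b₂, rfl⟩ := Ideal.Quotient.mk_surjective y₂
  have hb₁ : b₁ • s ≠ 0 := by
    intro h
    have h0 : b₁ • ψ₁ s = 0 := by rw [← map_smul, h, map_zero]
    rw [← hy₁, ← map_smul] at h0
    have h2 : Ideal.Quotient.mk (Ideal.jacobson (⊥ : Ideal k)) (b₁ * b₁) = 0 :=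
      hφ (h0.trans (map_zero φ).symm)
    rw [Ideal.Quotient.eq_zero_iff_mem, ← pow_two] at h2
    have h3 : b₁ ∈ Ideal.jacobson (⊥ : Ideal k) := by
      have := Ideal.isRadical_jacobson (⊥ : Ideal k)
      exact this ⟨2, h2⟩
    rw [Ideal.Quotient.eq_zero_iff_mem.mpr h3, map_zero] at hy₁
    exact hs hy₁.symm
  obtain ⟨c, hc⟩ := IsSimpleModule.toSpanSingleton_surjective k hb₁ s
  rw [LinearMap.toSpanSingleton_apply] at hc
  have key : (c * b₂) • ψ₁ s = ψ₂ s := by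
    have h2 : ψ₂ s = c • b₁ • ψ₂ s := by rw [← map_smul, ← map_smul, hc]
    rw [h2, ← hy₁, ← hy₂, ← map_smul φ, ← map_smul φ, ← map_smul φ]
    congr 1
    change Ideal.Quotient.mk _ (c * b₂ * b₁) = Ideal.Quotient.mk _ (c * (b₁ * b₂))
    congr 1
    ring
  refine ⟨c * b₂, LinearMap.ext fun s' => ?_⟩
  obtain ⟨a, rfl⟩ := IsSimpleModule.toSpanSingleton_surjective k hs0 s'
  rw [LinearMap.toSpanSingleton_apply, map_smul, map_smul, LinearMap.smul_apply, key]

/-- Dualizing does not increase the length. -/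
theorem length_dual_le
    (φ : (k ⧸ Ideal.jacobson (⊥ : Ideal k)) →ₗ[k] E) (hφ : Function.Injective φ)
    (hess : ∀ N : Submodule k E, N ≠ ⊥ → N ⊓ LinearMap.range φ ≠ ⊥)
    {X : Type} [AddCommGroup X] [Module k X] (hX : IsFiniteLength k X) :
    Module.length k (X →ₗ[k] E) ≤ Module.length k X := by
  induction hX with
  | of_subsingleton => simp
  | @of_simple_quotient X _ _ S _ _ ih =>
    have hsimple : Module.length k ((X ⧸ S) →ₗ[k] E) ≤ 1 := by
      rcases subsingleton_or_nontrivial ((X ⧸ S) →ₗ[k] E) with h | h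
      · simp
      · have : IsSimpleModule k ((X ⧸ S) →ₗ[k] E) :=
          isSimpleModule_iff_toSpanSingleton_surjective.mpr ⟨h, fun ψ₁ h₁ ψ₂ =>
            exists_smul_eq_of_isSimpleModule φ hφ hess h₁ ψ₂⟩
        exact (Module.length_eq_one k _).le
    let res : (X →ₗ[k] E) →ₗ[k] (S →ₗ[k] E) := LinearMap.lcomp k E S.subtype
    have hker : Module.length k (LinearMap.ker res) ≤ 1 := by
      refine le_trans (Module.length_le_of_surjective
        ((LinearMap.lcomp k E S.mkQ).codRestrict (LinearMap.ker res) ?_) ?_) hsimple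
      · intro ψ
        ext s
        change ψ (Submodule.Quotient.mk (s : X)) = 0
        rw [(Submodule.Quotient.mk_eq_zero S).mpr s.2, map_zero]
      · rintro ⟨ψ, hψ⟩
        have hS : S ≤ LinearMap.ker ψ := fun s hs => LinearMap.congr_fun hψ (⟨s, hs⟩ : S)
        exact ⟨S.liftQ ψ hS, Subtype.ext (Submodule.liftQ_mkQ S ψ hS)⟩
    rw [Module.length_eq_add_of_exact (LinearMap.ker res).subtype res.rangeRestrict
        (Submodule.injective_subtype _) res.surjective_rangeRestrict
        (by rw [LinearMap.exact_iff]; simp),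
      Module.length_eq_add_of_exact S.subtype S.mkQ (Submodule.injective_subtype _)
        S.mkQ_surjective (LinearMap.exact_subtype_mkQ S), Module.length_eq_one k (X ⧸ S),
      add_comm]
    exact add_le_add ((Module.length_le_of_injective _ (Submodule.injective_subtype _)).trans ih)
      hker

/-- A separating submodule of the dual of a finite module is everything. -/
theorem eq_top_of_separating [IsArtinianRing k]
    (φ : (k ⧸ Ideal.jacobson (⊥ : Ideal k)) →ₗ[k] E) (hφ : Function.Injective φ)
    (hess : ∀ N : Submodule k E, N ≠ ⊥ → N ⊓ LinearMap.range φ ≠ ⊥)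
    {X : Type} [AddCommGroup X] [Module k X] [Module.Finite k X]
    (V : Submodule k (X →ₗ[k] E)) (hV : ∀ x, (∀ v ∈ V, v x = 0) → x = 0) : V = ⊤ := by
  have hX : IsFiniteLength k X :=
    isFiniteLength_iff_isNoetherian_isArtinian.mpr ⟨inferInstance, inferInstance⟩
  have hDX := length_dual_le φ hφ hess hX
  have hfin := Module.length_ne_top_iff.mp
    (ne_top_of_le_ne_top (Module.length_ne_top_iff.mpr hX) hDX)
  obtain ⟨_, _⟩ := isFiniteLength_iff_isNoetherian_isArtinian.mp hfin
  have hV' : IsFiniteLength k V :=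
    isFiniteLength_iff_isNoetherian_isArtinian.mpr ⟨inferInstance, inferInstance⟩
  by_contra hne
  have hev : Function.Injective (V.subtype.flip : X →ₗ[k] V →ₗ[k] E) := by
    rw [injective_iff_map_eq_zero]
    exact fun x hx => hV x fun v hv => LinearMap.congr_fun hx ⟨v, hv⟩
  exact absurd (Submodule.length_lt hne) (not_lt.mpr
    (hDX.trans ((Module.length_le_of_injective _ hev).trans (length_dual_le φ hφ hess hV'))))

/-- A functional on a finite module that vanishes on the common kernel of a submodule `V` of the
dual belongs to `V`. -/
theorem mem_of_forall_apply_eq_zero [IsArtinianRing k]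
    (φ : (k ⧸ Ideal.jacobson (⊥ : Ideal k)) →ₗ[k] E) (hφ : Function.Injective φ)
    (hess : ∀ N : Submodule k E, N ≠ ⊥ → N ⊓ LinearMap.range φ ≠ ⊥)
    {X : Type} [AddCommGroup X] [Module k X] [Module.Finite k X]
    (V : Submodule k (X →ₗ[k] E)) (ψ : X →ₗ[k] E)
    (hψ : ∀ x, (∀ v ∈ V, v x = 0) → ψ x = 0) : ψ ∈ V := by
  let W : Submodule k X := ⨅ v ∈ V, LinearMap.ker v
  have hW : ∀ x, x ∈ W ↔ ∀ v ∈ V, v x = 0 := by simp [W]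
  have htop := eq_top_of_separating φ hφ hess (V.comap (LinearMap.lcomp k E W.mkQ)) fun x hx => by
    obtain ⟨x, rfl⟩ := W.mkQ_surjective x
    rw [Submodule.mkQ_apply, Submodule.Quotient.mk_eq_zero, hW]
    intro v hv
    have hvW : W ≤ LinearMap.ker v := fun y hy => (hW y).mp hy v hv
    have hmem : W.liftQ v hvW ∈ V.comap (LinearMap.lcomp k E W.mkQ) := by
      change (W.liftQ v hvW) ∘ₗ W.mkQ ∈ V
      rwa [Submodule.liftQ_mkQ]
    simpa using hx _ hmem
  have hψW : W ≤ LinearMap.ker ψ := fun y hy => hψ y ((hW y).mp hy)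
  have hmem : W.liftQ ψ hψW ∈ V.comap (LinearMap.lcomp k E W.mkQ) := htop ▸ Submodule.mem_top
  have : (W.liftQ ψ hψW) ∘ₗ W.mkQ ∈ V := hmem
  rwa [Submodule.liftQ_mkQ] at this

end Duality

section AlmostSplit

variable {Λ : Type} [Ring Λ]
  {M P Q T B : Type} [AddCommGroup M] [Module Λ M] [AddCommGroup P] [Module Λ P]
  [AddCommGroup Q] [Module Λ Q] [AddCommGroup T] [Module Λ T] [AddCommGroup B] [Module Λ B]

/-- A linear map killed by the second map of an exact sequence factors through the first one,
when the latter is injective. -/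
theorem exists_comp_eq_of_exact {i : T →ₗ[Λ] B} {p : B →ₗ[Λ] M} (hi : Function.Injective i)
    (hip : Function.Exact i p) {Z : Type} [AddCommGroup Z] [Module Λ Z] (l : Z →ₗ[Λ] B)
    (hl : p ∘ₗ l = 0) : ∃ t : Z →ₗ[Λ] T, i ∘ₗ t = l := by
  have hmem : ∀ z, l z ∈ LinearMap.range i := fun z => (hip _).mp (LinearMap.congr_fun hl z)
  refine ⟨(LinearEquiv.ofInjective i hi).symm ∘ₗ l.codRestrict _ hmem, LinearMap.ext fun z => ?_⟩
  exact LinearEquiv.ofInjective_symm_apply (f := i) (h := hi) ⟨l z, hmem z⟩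

/-- A linear map vanishing on the kernel of a surjection descends along it. -/
theorem exists_descent {g : Q →ₗ[Λ] M} (hg : Function.Surjective g)
    {Z : Type} [AddCommGroup Z] [Module Λ Z] (w : Q →ₗ[Λ] Z)
    (hw : LinearMap.ker g ≤ LinearMap.ker w) : ∃ s : M →ₗ[Λ] Z, s ∘ₗ g = w := by
  refine ⟨(LinearMap.ker g).liftQ w hw ∘ₗ (g.quotKerEquivOfSurjective hg).symm,
    LinearMap.ext fun q => ?_⟩
  have : (g.quotKerEquivOfSurjective hg).symm (g q) = Submodule.Quotient.mk q := by
    rw [LinearEquiv.symm_apply_eq]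
    rfl
  simp [this]

/-- The extension of `M` by `N` obtained by pushing out the presentation `P → Q → M` along a map
`u : P → N` vanishing on `ker f` splits only if `u` factors through `f`; otherwise it maps onto any
almost split sequence ending at `M`. -/
theorem exists_lift_of_not_factors [Module.Finite Λ Q] {f : P →ₗ[Λ] Q} {g : Q →ₗ[Λ] M}
    (hg : Function.Surjective g) (hfg : Function.Exact f g)
    {i : T →ₗ[Λ] B} {p : B →ₗ[Λ] M} (hAS : IsAlmostSplitSeq Λ i p)
    {N : Type} [AddCommGroup N] [Module Λ N] [Module.Finite Λ N] (u : P →ₗ[Λ] N)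
    (hu : LinearMap.ker f ≤ LinearMap.ker u) (hnf : ¬ ∃ w : Q →ₗ[Λ] N, w ∘ₗ f = u) :
    ∃ (t : N →ₗ[Λ] T) (w : Q →ₗ[Λ] B), p ∘ₗ w = g ∧ i ∘ₗ t ∘ₗ u = w ∘ₗ f := by
  obtain ⟨⟨hi, -, hip⟩, -, -, hlift, -⟩ := hAS
  let R : Submodule Λ (N × Q) := LinearMap.range (u.prod (-f))
  let j : N →ₗ[Λ] (N × Q) ⧸ R := R.mkQ ∘ₗ LinearMap.inl Λ N Q
  let c : Q →ₗ[Λ] (N × Q) ⧸ R := R.mkQ ∘ₗ LinearMap.inr Λ N Q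
  have hR : R ≤ LinearMap.ker (g ∘ₗ LinearMap.snd Λ N Q) := by
    rintro _ ⟨x, rfl⟩
    simp [hfg.apply_apply_eq_zero]
  let σ : ((N × Q) ⧸ R) →ₗ[Λ] M := R.liftQ (g ∘ₗ LinearMap.snd Λ N Q) hR
  have hjc : j ∘ₗ u = c ∘ₗ f := LinearMap.ext fun x => by
    change R.mkQ (u x, 0) = R.mkQ (0, f x)
    rw [← sub_eq_zero, ← map_sub]
    exact (Submodule.Quotient.mk_eq_zero R).mpr ⟨x, by simp⟩
  have hσc : σ ∘ₗ c = g := LinearMap.ext fun q => rfl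
  have hσj : σ ∘ₗ j = 0 := LinearMap.ext fun n => map_zero g
  have hσ : Function.Surjective σ := fun m => (hg m).imp' c fun q hq => hq
  have hj : Function.Injective j := by
    rw [injective_iff_map_eq_zero]
    intro n hn
    obtain ⟨x, hx⟩ := (Submodule.Quotient.mk_eq_zero R).mp hn
    have h1 : u x = n := congrArg Prod.fst hx
    have h2 : -f x = 0 := congrArg Prod.snd hx
    rw [← h1]
    exact hu (neg_eq_zero.mp h2)
  have hjσ : Function.Exact j σ := by
    intro y
    refine ⟨fun hy => ?_, ?_⟩
    · obtain ⟨⟨n, q⟩, rfl⟩ := R.mkQ_surjective y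
      obtain ⟨x, rfl⟩ := (hfg q).mp hy
      refine ⟨n + u x, ?_⟩
      change R.mkQ (n + u x, 0) = R.mkQ (n, f x)
      rw [← sub_eq_zero, ← map_sub]
      exact (Submodule.Quotient.mk_eq_zero R).mpr ⟨x, by simp⟩
    · rintro ⟨n, rfl⟩
      exact LinearMap.congr_fun hσj n
  have hns : ¬ ∃ s : M →ₗ[Λ] (N × Q) ⧸ R, σ ∘ₗ s = LinearMap.id := by
    intro hs
    obtain ⟨r, hr⟩ := ((hjσ.split_tfae hj hσ).out 0 1).mp hs
    exact hnf ⟨r ∘ₗ c, by rw [LinearMap.comp_assoc, ← hjc, ← LinearMap.comp_assoc, hr,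
      LinearMap.id_comp]⟩
  obtain ⟨l, hl⟩ := hlift _ σ hns
  obtain ⟨t, ht⟩ := exists_comp_eq_of_exact hi hip (l ∘ₗ j)
    (by rw [← LinearMap.comp_assoc, hl, hσj])
  refine ⟨t, l ∘ₗ c, by rw [← LinearMap.comp_assoc, hl, hσc], ?_⟩
  rw [← LinearMap.comp_assoc, ht, LinearMap.comp_assoc, hjc]
  rfl

/-- An almost split sequence ending at `M`, seen as a class `u₀` in `Hom(P, T)` modulo `Hom(Q, T)`:
it is nonzero, it lies in the image of every nonzero map into `T`, and every nonzero class
of an extension of `M` can be mapped onto it. -/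
theorem exists_class_of_isAlmostSplitSeq [Module.Finite Λ Q] [Module.Finite Λ T]
    [Module.Projective Λ P] [Module.Projective Λ Q] {f : P →ₗ[Λ] Q} {g : Q →ₗ[Λ] M}
    (hg : Function.Surjective g) (hfg : Function.Exact f g)
    {i : T →ₗ[Λ] B} {p : B →ₗ[Λ] M} (hAS : IsAlmostSplitSeq Λ i p) :
    ∃ u₀ : P →ₗ[Λ] T,
      (¬ ∃ w : Q →ₗ[Λ] T, w ∘ₗ f = u₀) ∧
      (∀ (N : Type) [AddCommGroup N] [Module Λ N] (t : N →ₗ[Λ] T), t ≠ 0 →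
        ∃ (v : P →ₗ[Λ] N) (w : Q →ₗ[Λ] T), t ∘ₗ v = u₀ - w ∘ₗ f) ∧
      (∀ (N : Type) [AddCommGroup N] [Module Λ N] [Module.Finite Λ N] (u : P →ₗ[Λ] N),
        LinearMap.ker f ≤ LinearMap.ker u → (¬ ∃ w : Q →ₗ[Λ] N, w ∘ₗ f = u) →
        ∃ (t : N →ₗ[Λ] T) (w : Q →ₗ[Λ] T), t ∘ₗ u = u₀ + w ∘ₗ f) := by
  obtain ⟨⟨hi, hp, hip⟩, -, hns, -, hext⟩ := id hAS
  obtain ⟨q₀, hq₀⟩ := Module.projective_lifting_property p g hp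
  obtain ⟨u₀, hu₀⟩ := exists_comp_eq_of_exact hi hip (q₀ ∘ₗ f)
    (by rw [← LinearMap.comp_assoc, hq₀]; exact hfg.linearMap_comp_eq_zero)
  have hpi : p ∘ₗ i = 0 := hip.linearMap_comp_eq_zero
  refine ⟨u₀, ?_, ?_, ?_⟩
  · rintro ⟨w, hw⟩
    obtain ⟨s, hs⟩ := exists_descent hg (q₀ - i ∘ₗ w) fun q hq => by
      obtain ⟨x, rfl⟩ := (hfg q).mp hq
      have h1 := LinearMap.congr_fun hu₀ x
      rw [← hw] at h1
      simpa [sub_eq_zero] using h1.symm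
    refine hns ⟨s, LinearMap.ext fun m => ?_⟩
    obtain ⟨q, rfl⟩ := hg m
    have h1 : s (g q) = q₀ q - i (w q) := LinearMap.congr_fun hs q
    have h2 : p (i (w q)) = 0 := LinearMap.congr_fun hpi _
    have h3 : p (q₀ q) = g q := LinearMap.congr_fun hq₀ q
    simp [h1, h2, h3]
  · intro N _ _ t ht
    obtain ⟨l, hl⟩ := hext (T ⧸ LinearMap.range t) (LinearMap.range t).mkQ <| by
      rintro ⟨r, hr⟩
      refine ht (LinearMap.ext fun n => ?_)
      have h1 : r ((LinearMap.range t).mkQ (t n)) = t n := LinearMap.congr_fun hr (t n)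
      have h2 : (LinearMap.range t).mkQ (t n) = 0 :=
        (Submodule.Quotient.mk_eq_zero _).mpr ⟨n, rfl⟩
      rw [← h1, h2, map_zero, LinearMap.zero_apply]
    obtain ⟨w, hw⟩ := Module.projective_lifting_property (LinearMap.range t).mkQ (l ∘ₗ q₀)
      (Submodule.mkQ_surjective _)
    have hmem : ∀ x, (u₀ - w ∘ₗ f) x ∈ LinearMap.range t := fun x => by
      rw [← Submodule.Quotient.mk_eq_zero, ← Submodule.mkQ_apply, LinearMap.sub_apply, map_sub,
        sub_eq_zero]
      have h1 : l (i (u₀ x)) = (LinearMap.range t).mkQ (u₀ x) := LinearMap.congr_fun hl _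
      have h2 : i (u₀ x) = q₀ (f x) := LinearMap.congr_fun hu₀ x
      have h3 : (LinearMap.range t).mkQ (w (f x)) = l (q₀ (f x)) := LinearMap.congr_fun hw _
      rw [← h1, h2, ← h3, LinearMap.comp_apply]
    obtain ⟨v, hv⟩ := Module.projective_lifting_property t.rangeRestrict
      ((u₀ - w ∘ₗ f).codRestrict _ hmem) t.surjective_rangeRestrict
    exact ⟨v, w, LinearMap.ext fun x => congrArg Subtype.val (LinearMap.congr_fun hv x)⟩
  · intro N _ _ _ u hu hnf
    obtain ⟨t, w, hpw, htw⟩ := exists_lift_of_not_factors hg hfg hAS u hu hnf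
    obtain ⟨d, hd⟩ := exists_comp_eq_of_exact hi hip (w - q₀)
      (by rw [LinearMap.comp_sub, hpw, hq₀, sub_self])
    refine ⟨t, d, LinearMap.ext fun x => hi ?_⟩
    have h1 : i (t (u x)) = w (f x) := LinearMap.congr_fun htw x
    have h2 : i (u₀ x) = q₀ (f x) := LinearMap.congr_fun hu₀ x
    have h3 : i (d (f x)) = w (f x) - q₀ (f x) := LinearMap.congr_fun hd (f x)
    simp [h1, h2, h3]

/-- A map to a simple module vanishes on superfluous submodules. -/
theorem le_ker_of_isSimpleModule (L : Submodule Λ P)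
    (hL : ∀ N : Submodule Λ P, N ⊔ L = ⊤ → N = ⊤)
    {S : Type} [AddCommGroup S] [Module Λ S] [IsSimpleModule Λ S] (v : P →ₗ[Λ] S) :
    L ≤ LinearMap.ker v := by
  rcases LinearMap.surjective_or_eq_zero v with hv | rfl
  · have hco : IsCoatom (LinearMap.ker v) := LinearMap.isCoatom_ker_of_surjective hv
    by_contra hle
    exact hco.1 (hL _ (hco.2 _ (left_lt_sup.mpr hle)))
  · simp

end AlmostSplit

section Duality

variable {k : Type} [CommRing k] {Λ : Type} [Ring Λ] [Algebra k Λ]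

/-- Hom modules between finite modules are finite over the base ring. -/
theorem finite_linearMap [IsArtinianRing k] [Module.Finite k Λ]
    (P : Type) [AddCommGroup P] [Module Λ P] [Module.Finite Λ P]
    (N : Type) [AddCommGroup N] [Module k N] [Module Λ N] [IsScalarTower k Λ N]
    [SMulCommClass Λ k N] [Module.Finite Λ N] : Module.Finite k (P →ₗ[Λ] N) := by
  have : Module.Finite k N := Module.Finite.trans Λ N
  obtain ⟨n, e, he⟩ := Module.Finite.exists_fin' Λ P
  let ev : (P →ₗ[Λ] N) →ₗ[k] (Fin n → N) :=
    { toFun := fun u j => u (e (Pi.single j 1))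
      map_add' := fun _ _ => rfl
      map_smul' := fun _ _ => rfl }
  refine Module.Finite.of_injective ev fun u u' h => ?_
  have : u ∘ₗ e = u' ∘ₗ e := LinearMap.pi_ext' fun j => LinearMap.ext_ring (congrFun h j)
  exact (LinearMap.cancel_right he).mp this

/-- The pairing `(t, u) ↦ θ (t ∘ u)` between `Hom(N, T)` and `Hom(P, N)` defined by a functional
`θ` on `Hom(P, T)`. -/
def compPairing {E : Type} [AddCommGroup E] [Module k E]
    {P : Type} [AddCommGroup P] [Module Λ P]
    {T : Type} [AddCommGroup T] [Module k T] [Module Λ T] [IsScalarTower k Λ T]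
    [SMulCommClass Λ k T] (θ : (P →ₗ[Λ] T) →ₗ[k] E)
    (N : Type) [AddCommGroup N] [Module k N] [Module Λ N] [IsScalarTower k Λ N]
    [SMulCommClass Λ k N] : (N →ₗ[Λ] T) →ₗ[k] (P →ₗ[Λ] N) →ₗ[k] E :=
  LinearMap.mk₂ k (fun t u => θ (t ∘ₗ u))
    (fun t t' u => by rw [LinearMap.add_comp, map_add])
    (fun c t u => by rw [LinearMap.smul_comp, map_smul])
    (fun t u u' => by rw [LinearMap.comp_add, map_add])
    (fun c t u => by
      rw [← map_smul]
      exact congrArg θ (LinearMap.ext fun x => t.map_smul_of_tower c (u x)))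

@[simp]
theorem compPairing_apply {E : Type} [AddCommGroup E] [Module k E]
    {P : Type} [AddCommGroup P] [Module Λ P]
    {T : Type} [AddCommGroup T] [Module k T] [Module Λ T] [IsScalarTower k Λ T]
    [SMulCommClass Λ k T] (θ : (P →ₗ[Λ] T) →ₗ[k] E)
    (N : Type) [AddCommGroup N] [Module k N] [Module Λ N] [IsScalarTower k Λ N]
    [SMulCommClass Λ k N] (t : N →ₗ[Λ] T) (u : P →ₗ[Λ] N) :
    compPairing θ N t u = θ (t ∘ₗ u) := rfl

/-- Let `θ` be a functional on `Hom(P, T)` such that every map `u : P → N` with `ker f ≤ ker u` not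
factoring through `f` is detected by some `θ (t ∘ u)`. Then every functional on
`Hom(P, N)` vanishing on the maps that factor through `f` agrees with some `u ↦ θ (t ∘ u)` on the
maps vanishing on `ker f`. -/
theorem exists_eq_comp_of_ker_le [IsArtinianRing k] [Module.Finite k Λ]
    {E : Type} [AddCommGroup E] [Module k E]
    (φ : (k ⧸ Ideal.jacobson (⊥ : Ideal k)) →ₗ[k] E) (hφ : Function.Injective φ)
    (hess : ∀ N : Submodule k E, N ≠ ⊥ → N ⊓ LinearMap.range φ ≠ ⊥)
    {P Q : Type} [AddCommGroup P] [Module Λ P] [Module.Finite Λ P]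
    [AddCommGroup Q] [Module Λ Q] (f : P →ₗ[Λ] Q)
    {T : Type} [AddCommGroup T] [Module k T] [Module Λ T] [IsScalarTower k Λ T]
    [SMulCommClass Λ k T] (θ : (P →ₗ[Λ] T) →ₗ[k] E)
    (N : Type) [AddCommGroup N] [Module k N] [Module Λ N] [IsScalarTower k Λ N]
    [SMulCommClass Λ k N] [Module.Finite Λ N]
    (hdetect : ∀ u : P →ₗ[Λ] N, LinearMap.ker f ≤ LinearMap.ker u →
      (¬ ∃ w : Q →ₗ[Λ] N, w ∘ₗ f = u) → ∃ t : N →ₗ[Λ] T, θ (t ∘ₗ u) ≠ 0)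
    (ψ : (P →ₗ[Λ] N) →ₗ[k] E) (hψ : ∀ w : Q →ₗ[Λ] N, ψ (w ∘ₗ f) = 0) :
    ∃ t : N →ₗ[Λ] T, ∀ u : P →ₗ[Λ] N, LinearMap.ker f ≤ LinearMap.ker u → ψ u = θ (t ∘ₗ u) := by
  have := finite_linearMap (k := k) (Λ := Λ) P N
  let H : Submodule k (P →ₗ[Λ] N) :=
    { carrier := {u | LinearMap.ker f ≤ LinearMap.ker u}
      add_mem' := fun {u u'} hu hu' x hx => by
        have h1 : u x = 0 := hu hx
        have h2 : u' x = 0 := hu' hx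
        simp [h1, h2]
      zero_mem' := fun x _ => rfl
      smul_mem' := fun c u hu x hx => by
        have h1 : u x = 0 := hu hx
        simp [h1] }
  obtain ⟨t, ht⟩ := mem_of_forall_apply_eq_zero φ hφ hess
    (LinearMap.range (LinearMap.lcomp k E H.subtype ∘ₗ compPairing θ N)) (ψ ∘ₗ H.subtype) <| by
      rintro ⟨u, hu⟩ h
      by_contra hne
      obtain ⟨t, ht⟩ := hdetect u hu <| by
        rintro ⟨w, rfl⟩
        exact hne (hψ w)
      exact ht (h _ ⟨t, rfl⟩)
  exact ⟨t, fun u hu => (LinearMap.congr_fun ht ⟨u, hu⟩).symm⟩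

/-- Let `θ` be a functional on `Hom(P, T)` which vanishes on the maps factoring through `f`, and
such that every map `u : P → N` with `ker f ≤ ker u` not factoring through `f` is
detected by some `θ (t ∘ u)`. If `ker f` is superfluous, then every functional on `Hom(P, N)`
vanishing on the maps that factor through `f` is of the form `u ↦ θ (t ∘ u)`. -/
theorem exists_eq_comp [IsArtinianRing k] [Module.Finite k Λ]
    {E : Type} [AddCommGroup E] [Module k E] (hE : Module.Injective k E)
    (φ : (k ⧸ Ideal.jacobson (⊥ : Ideal k)) →ₗ[k] E) (hφ : Function.Injective φ)
    (hess : ∀ N : Submodule k E, N ≠ ⊥ → N ⊓ LinearMap.range φ ≠ ⊥)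
    {P Q : Type} [AddCommGroup P] [Module Λ P] [Module.Finite Λ P]
    [AddCommGroup Q] [Module Λ Q] [Module.Projective Λ Q] (f : P →ₗ[Λ] Q)
    (hf : ∀ N : Submodule Λ P, N ⊔ LinearMap.ker f = ⊤ → N = ⊤)
    {T : Type} [AddCommGroup T] [Module k T] [Module Λ T] [IsScalarTower k Λ T]
    [SMulCommClass Λ k T] (θ : (P →ₗ[Λ] T) →ₗ[k] E) (hθ : ∀ w : Q →ₗ[Λ] T, θ (w ∘ₗ f) = 0)
    (hdetect : ∀ (N : Type) [AddCommGroup N] [Module Λ N] [Module.Finite Λ N] (u : P →ₗ[Λ] N),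
      LinearMap.ker f ≤ LinearMap.ker u → (¬ ∃ w : Q →ₗ[Λ] N, w ∘ₗ f = u) →
      ∃ t : N →ₗ[Λ] T, θ (t ∘ₗ u) ≠ 0)
    (N : Type) [AddCommGroup N] [Module k N] [Module Λ N] [IsScalarTower k Λ N]
    [SMulCommClass Λ k N] [Module.Finite Λ N]
    (ψ : (P →ₗ[Λ] N) →ₗ[k] E) (hψ : ∀ w : Q →ₗ[Λ] N, ψ (w ∘ₗ f) = 0) :
    ∃ t : N →ₗ[Λ] T, ∀ u : P →ₗ[Λ] N, ψ u = θ (t ∘ₗ u) := by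
  have : IsArtinianRing Λ := IsArtinianRing.of_finite k Λ
  generalize hn : Module.length Λ N = n
  induction n using WellFoundedLT.induction generalizing N with
  | ind n ih =>
    rcases subsingleton_or_nontrivial N with hN | hN
    · exact ⟨0, fun u => by rw [Subsingleton.elim u 0, LinearMap.comp_zero, map_zero, map_zero]⟩
    obtain ⟨t, ht⟩ := exists_eq_comp_of_ker_le φ hφ hess f θ N (hdetect N) ψ hψ
    obtain ⟨S, hS, -⟩ := (eq_bot_or_exists_atom_le (⊤ : Submodule Λ N)).resolve_left top_ne_bot
    have : IsSimpleModule Λ S := isSimpleModule_iff_isAtom.mpr hS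
    let push : (P →ₗ[Λ] N) →ₗ[k] (P →ₗ[Λ] N ⧸ S) :=
      { toFun := fun u => S.mkQ ∘ₗ u
        map_add' := fun _ _ => LinearMap.comp_add _ _ _
        map_smul' := fun _ _ => rfl }
    obtain ⟨χ, hχ⟩ := exists_comp_eq_of_ker_le hE push (ψ - compPairing θ N t) fun u hu => by
      have hmem : ∀ x, u x ∈ S := fun x =>
        (Submodule.Quotient.mk_eq_zero S).mp (LinearMap.congr_fun hu x)
      have hker : LinearMap.ker f ≤ LinearMap.ker u := by
        rw [← LinearMap.ker_codRestrict S u hmem]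
        exact le_ker_of_isSimpleModule _ hf _
      exact sub_eq_zero.mpr (ht u hker)
    obtain ⟨t', ht'⟩ := ih (Module.length Λ (N ⧸ S)) (hn ▸ Submodule.length_quotient_lt S hS.1)
      (N ⧸ S) χ (fun w => by
        obtain ⟨w, rfl⟩ := Module.projective_lifting_property S.mkQ w S.mkQ_surjective
        have h1 := LinearMap.congr_fun hχ (w ∘ₗ f)
        rw [LinearMap.sub_apply, hψ, compPairing_apply, ← LinearMap.comp_assoc, hθ, sub_zero] at h1
        exact h1) rfl
    refine ⟨t + t' ∘ₗ S.mkQ, fun u => ?_⟩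
    have h1 : χ (S.mkQ ∘ₗ u) = ψ u - θ (t ∘ₗ u) := LinearMap.congr_fun hχ u
    rw [LinearMap.add_comp, map_add, LinearMap.comp_assoc, ← ht', h1, add_sub_cancel]

end Duality

theorem statement12 [IsArtinianRing k] [Module.Finite k Λ]
    -- the injective envelope E of k/r and the duality D = Hom_k(−,E)
    (E : Type) [AddCommGroup E] [Module k E] (hEinj : Module.Injective k E)
    (φ : (k ⧸ Ideal.jacobson (⊥ : Ideal k)) →ₗ[k] E)
    (hφmono : Function.Injective φ)
    (hφess : ∀ N : Submodule k E, N ≠ ⊥ → N ⊓ LinearMap.range φ ≠ ⊥)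
    -- M : an indecomposable non-projective finitely generated Λ-module
    (M : Type) [AddCommGroup M] [Module k M] [Module Λ M] [IsScalarTower k Λ M]
      [SMulCommClass Λ k M] [Module.Finite Λ M]
    (hMind : IndecMod Λ M) (hMnp : ¬ Module.Projective Λ M)
    -- minimal projective presentation P →f Q →g M → 0
    (P : Type) [AddCommGroup P] [Module k P] [Module Λ P] [IsScalarTower k Λ P]
      [SMulCommClass Λ k P] [Module.Finite Λ P]
    (Q : Type) [AddCommGroup Q] [Module k Q] [Module Λ Q] [IsScalarTower k Λ Q]
      [SMulCommClass Λ k Q] [Module.Finite Λ Q]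
    (f : P →ₗ[Λ] Q) (g : Q →ₗ[Λ] M)
    (hP : Module.Projective Λ P) (hQ : Module.Projective Λ Q)
    (hgsurj : Function.Surjective g) (hexact : Function.Exact f g)
    (hcover_g : ∀ N : Submodule Λ Q, N ⊔ LinearMap.ker g = ⊤ → N = ⊤)
    (hcover_f : ∀ N : Submodule Λ P, N ⊔ LinearMap.ker f = ⊤ → N = ⊤)
    -- almost split sequence 0 → T → B → M → 0  (so T = τ(M))
    (T : Type) [AddCommGroup T] [Module k T] [Module Λ T] [IsScalarTower k Λ T]
      [SMulCommClass Λ k T] [Module.Finite Λ T]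
    (B : Type) [AddCommGroup B] [Module Λ B] [Module.Finite Λ B]
    (i : T →ₗ[Λ] B) (p : B →ₗ[Λ] M) (hAS : IsAlmostSplitSeq Λ i p) :
    -- conclusion: a natural monomorphism Hom_Λ(−,T) → D ∘ Hom_Λ(P,−) with the
    -- stated four-term exact sequences
    ∃ η : ∀ (N : Type) [AddCommGroup N] [Module k N] [Module Λ N] [IsScalarTower k Λ N]
        [SMulCommClass Λ k N] [Module.Finite Λ N],
        (N →ₗ[Λ] T) →ₗ[k] ((P →ₗ[Λ] N) →ₗ[k] E),
      -- η is natural in N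
      (∀ (N : Type) [AddCommGroup N] [Module k N] [Module Λ N] [IsScalarTower k Λ N]
          [SMulCommClass Λ k N] [Module.Finite Λ N]
        (N' : Type) [AddCommGroup N'] [Module k N'] [Module Λ N'] [IsScalarTower k Λ N']
          [SMulCommClass Λ k N'] [Module.Finite Λ N']
        (α : N →ₗ[Λ] N') (t : N' →ₗ[Λ] T) (u : P →ₗ[Λ] N),
          η N (t ∘ₗ α) u = η N' t (α ∘ₗ u)) ∧
      -- for every finitely generated N, the sequence
      -- 0 → Hom(N,T) → D(Hom(P,N)) → D(Hom(Q,N)) → D(Hom(M,N)) → 0 is exact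
      (∀ (N : Type) [AddCommGroup N] [Module k N] [Module Λ N] [IsScalarTower k Λ N]
          [SMulCommClass Λ k N] [Module.Finite Λ N],
        Function.Injective (η N) ∧
        Function.Exact (η N)
          (fun ψ : (P →ₗ[Λ] N) →ₗ[k] E => ψ ∘ₗ pre k Λ f N) ∧
        Function.Exact (fun ψ : (P →ₗ[Λ] N) →ₗ[k] E => ψ ∘ₗ pre k Λ f N)
          (fun ψ : (Q →ₗ[Λ] N) →ₗ[k] E => ψ ∘ₗ pre k Λ g N) ∧
        Function.Surjective
          (fun ψ : (Q →ₗ[Λ] N) →ₗ[k] E => ψ ∘ₗ pre k Λ g N)) := by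
  obtain ⟨u₀, hu₀, hinj, hdetect⟩ := exists_class_of_isAlmostSplitSeq hgsurj hexact hAS
  obtain ⟨θ', hθ'⟩ := exists_apply_ne_zero hEinj φ hφmono
    (x := (LinearMap.range (pre k Λ f T)).mkQ u₀)
    (fun h => hu₀ ((Submodule.Quotient.mk_eq_zero _).mp h))
  let θ : (P →ₗ[Λ] T) →ₗ[k] E := θ' ∘ₗ (LinearMap.range (pre k Λ f T)).mkQ
  have hθf : ∀ w : Q →ₗ[Λ] T, θ (w ∘ₗ f) = 0 := fun w => by
    have : (LinearMap.range (pre k Λ f T)).mkQ (w ∘ₗ f) = 0 :=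
      (Submodule.Quotient.mk_eq_zero _).mpr ⟨w, rfl⟩
    rw [LinearMap.comp_apply, this, map_zero]
  have hθu₀ : θ u₀ ≠ 0 := hθ'
  refine ⟨fun N => compPairing θ N, fun N _ _ _ _ _ _ N' _ _ _ _ _ _ α t u => rfl, ?_⟩
  intro N _ _ _ _ _ _
  refine ⟨?_, ?_, ?_, ?_⟩
  · rw [injective_iff_map_eq_zero]
    intro t ht
    by_contra hne
    obtain ⟨v, w, hvw⟩ := hinj N t hne
    have h1 : θ (t ∘ₗ v) = 0 := LinearMap.congr_fun ht v
    rw [hvw, map_sub, hθf, sub_zero] at h1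
    exact hθu₀ h1
  · intro ψ
    refine ⟨fun h => ?_, ?_⟩
    · obtain ⟨t, ht⟩ := exists_eq_comp hEinj φ hφmono hφess f hcover_f θ hθf
        (fun N _ _ _ u hu hnf => by
          obtain ⟨t, w, htw⟩ := hdetect N u hu hnf
          exact ⟨t, by rwa [htw, map_add, hθf, add_zero]⟩) N ψ
        (fun w => LinearMap.congr_fun h w)
      exact ⟨t, LinearMap.ext fun u => (ht u).symm⟩
    · rintro ⟨t, rfl⟩
      exact LinearMap.ext fun w => hθf (t ∘ₗ w)
  · intro ψ
    refine ⟨fun h => ?_, ?_⟩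
    · refine exists_comp_eq_of_ker_le hEinj (pre k Λ f N) ψ fun w hw => ?_
      obtain ⟨s, rfl⟩ := exists_descent hgsurj w fun q hq => by
        obtain ⟨x, rfl⟩ := (hexact q).mp hq
        exact LinearMap.congr_fun hw x
      exact LinearMap.congr_fun h s
    · rintro ⟨χ, rfl⟩
      refine LinearMap.ext fun s => ?_
      have : pre k Λ f N (pre k Λ g N s) = 0 := LinearMap.ext fun x => by
        change s (g (f x)) = 0
        rw [hexact.apply_apply_eq_zero, map_zero]
      change χ (pre k Λ f N (pre k Λ g N s)) = 0
      rw [this, map_zero]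
  · intro χ
    refine exists_comp_eq_of_ker_le hEinj (pre k Λ g N) χ fun s hs => ?_
    have : s = 0 := (LinearMap.cancel_right hgsurj).mp hs
    rw [this]
    exact zero_mem _

end Statement12
end

section
/- Let Λ be an Artin algebra over the commutative artinian ring k, with duality D = Hom_k(−,E). Let M be an indecomposable non-projective finitely generated Λ-module, let 0 → M → B → T → 0 be an almost split sequence in mod-Λ (so T = τ^{-1}(M)), and let P →f Q →g T → 0 be a minimal projective presentation of T. Then there exists a natural transformation ε : Hom_Λ(P,−) → D∘Hom_Λ(−,M) of functors on mod-Λ such that for every finitely generated Λ-module N the sequence 0 → Hom_Λ(T,N) → Hom_Λ(Q,N) → Hom_Λ(P,N) → D(Hom_Λ(N,M)) → 0 is exact, where the second and third maps are composition with g and with f; in other words, the functor Hom_Λ(τ^{-1}(M),−) is a second syzygy of the injective functor D∘Hom_Λ(−,M). -/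
/-!
STATEMENT 13: Let Λ be an Artin algebra over a commutative artinian ring k with
duality D = Hom_k(−,E).  Let M be an indecomposable non-projective f.g. Λ-module,
0 → M → B → T → 0 an almost split sequence (so T = τ⁻¹(M)), and P →f Q →g T → 0 a
minimal projective presentation of T.  Then there is a natural transformation
ε : Hom_Λ(P,−) → D∘Hom_Λ(−,M) such that for every f.g. Λ-module N the sequence
  0 → Hom_Λ(T,N) → Hom_Λ(Q,N) → Hom_Λ(P,N) → D(Hom_Λ(N,M)) → 0
is exact, the second and third maps being composition with g and with f; i.e.
Hom_Λ(τ⁻¹(M),−) is a second syzygy of the injective functor D∘Hom_Λ(−,M).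
-/

open Function

namespace Statement13

variable (k : Type) [CommRing k] (Λ : Type) [Ring Λ] [Algebra k Λ]

/-- An indecomposable module. -/
def IndecMod (V : Type) [AddCommGroup V] [Module Λ V] : Prop :=
  Nontrivial V ∧ ∀ N₁ N₂ : Submodule Λ V, IsCompl N₁ N₂ → N₁ = ⊥ ∨ N₂ = ⊥

/-- `(i, p)` is an almost split sequence of finitely generated Λ-modules. -/
def IsAlmostSplitSeq {T B C : Type} [AddCommGroup T] [Module Λ T]
    [AddCommGroup B] [Module Λ B] [AddCommGroup C] [Module Λ C]
    (i : T →ₗ[Λ] B) (p : B →ₗ[Λ] C) : Prop :=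
  (Function.Injective i ∧ Function.Surjective p ∧ Function.Exact i p) ∧
  ¬ (∃ r : B →ₗ[Λ] T, r ∘ₗ i = LinearMap.id) ∧
  ¬ (∃ s : C →ₗ[Λ] B, p ∘ₗ s = LinearMap.id) ∧
  (∀ (Z : Type) [AddCommGroup Z] [Module Λ Z] [Module.Finite Λ Z],
    ∀ t : Z →ₗ[Λ] C, ¬ (∃ s : C →ₗ[Λ] Z, t ∘ₗ s = LinearMap.id) →
      ∃ l : Z →ₗ[Λ] B, p ∘ₗ l = t) ∧
  (∀ (Z : Type) [AddCommGroup Z] [Module Λ Z] [Module.Finite Λ Z],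
    ∀ t : T →ₗ[Λ] Z, ¬ (∃ r : Z →ₗ[Λ] T, r ∘ₗ t = LinearMap.id) →
      ∃ l : B →ₗ[Λ] Z, l ∘ₗ i = t)

section Duality

variable {R : Type} [CommRing R]

/-- Over a commutative artinian ring `R`, every simple module embeds into `R` modulo its radical. -/
lemma exists_ne_zero_smul_eq_zero_of_isMaximal [IsArtinianRing R] (m : Ideal R) [m.IsMaximal] :
    ∃ y : R ⧸ Ideal.jacobson (⊥ : Ideal R), y ≠ 0 ∧ ∀ a ∈ m, a • y = 0 := by
  have : IsSemisimpleRing (R ⧸ Ideal.jacobson (⊥ : Ideal R)) := by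
    rw [Ideal.jacobson_bot]
    infer_instance
  have hle : Ideal.jacobson (⊥ : Ideal R) ≤ m := sInf_le ⟨bot_le, inferInstance⟩
  obtain ⟨C, hC⟩ := exists_isCompl (m.map (Ideal.Quotient.mk (Ideal.jacobson (⊥ : Ideal R))))
  have hCbot : C ≠ ⊥ := by
    rintro rfl
    have htop := hC.sup_eq_top
    rw [sup_bot_eq] at htop
    have hcomap := congrArg (Ideal.comap (Ideal.Quotient.mk _)) htop
    rw [Ideal.comap_map_of_surjective _ Ideal.Quotient.mk_surjective, Ideal.comap_top,
      ← RingHom.ker_eq_comap_bot, Ideal.mk_ker, sup_eq_left.mpr hle] at hcomap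
    exact Ideal.IsMaximal.ne_top ‹_› hcomap
  obtain ⟨y, hyC, hy⟩ := Submodule.exists_mem_ne_zero_of_ne_bot hCbot
  refine ⟨y, hy, fun a ha => ?_⟩
  rw [Algebra.smul_def, ← Submodule.mem_bot (R ⧸ Ideal.jacobson (⊥ : Ideal R)), ← hC.inf_eq_bot]
  exact ⟨Ideal.mul_mem_right _ _ (Ideal.mem_map_of_mem _ ha), Ideal.mul_mem_left _ _ hyC⟩

/-- The `m`-torsion of `R` modulo its radical is generated by any of its nonzero elements. -/
lemma exists_eq_smul_of_smul_eq_zero (m : Ideal R) [m.IsMaximal]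
    {y z : R ⧸ Ideal.jacobson (⊥ : Ideal R)} (hy : y ≠ 0)
    (hmy : ∀ a ∈ m, a • y = 0) (hmz : ∀ a ∈ m, a • z = 0) : ∃ c : R, z = c • y := by
  obtain ⟨a, rfl⟩ := Ideal.Quotient.mk_surjective y
  obtain ⟨b, rfl⟩ := Ideal.Quotient.mk_surjective z
  have ham : a ∉ m := by
    intro ha
    have h := hmy a ha
    rw [Algebra.smul_def, Ideal.Quotient.algebraMap_eq, ← map_mul,
      Ideal.Quotient.eq_zero_iff_mem] at h
    refine hy (Ideal.Quotient.eq_zero_iff_mem.mpr (Ideal.isRadical_jacobson _ ⟨2, ?_⟩))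
    rwa [pow_two]
  obtain ⟨c, hc⟩ := Ideal.IsMaximal.exists_inv ‹_› ham
  obtain ⟨i, hi, hci⟩ := hc
  refine ⟨c * b, ?_⟩
  have h := hmz i hi
  rw [Algebra.smul_def, Ideal.Quotient.algebraMap_eq] at h ⊢
  have h1 := congrArg (Ideal.Quotient.mk (Ideal.jacobson (⊥ : Ideal R))) hci
  simp only [map_add, map_mul, map_one] at h1 ⊢
  linear_combination (-(Ideal.Quotient.mk (Ideal.jacobson (⊥ : Ideal R)) b)) * h1 + h

variable {E : Type} [AddCommGroup E] [Module R E]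
  (φ : (R ⧸ Ideal.jacobson (⊥ : Ideal R)) →ₗ[R] E)

/-- An essential extension contains every element annihilated by a maximal ideal. -/
lemma mem_range_of_smul_eq_zero
    (hφess : ∀ N : Submodule R E, N ≠ ⊥ → N ⊓ LinearMap.range φ ≠ ⊥)
    (m : Ideal R) [m.IsMaximal] {x : E} (hmx : ∀ a ∈ m, a • x = 0) :
    x ∈ LinearMap.range φ := by
  rcases eq_or_ne x 0 with rfl | hx
  · exact zero_mem _
  have hspan : Submodule.span R {x} ≠ ⊥ := by simpa using hx
  obtain ⟨w, ⟨hw, hwφ⟩, hw0⟩ := Submodule.exists_mem_ne_zero_of_ne_bot (hφess _ hspan)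
  obtain ⟨a, rfl⟩ := Submodule.mem_span_singleton.mp hw
  have ha : a ∉ m := fun ha => hw0 (hmx a ha)
  obtain ⟨c, i, hi, hci⟩ := Ideal.IsMaximal.exists_inv ‹_› ha
  have hxeq : x = c • a • x := by
    rw [smul_smul, ← add_zero ((c * a) • x), ← hmx i hi, ← add_smul, hci, one_smul]
  rw [hxeq]
  exact Submodule.smul_mem _ _ hwφ

lemma length_dual_le_one_of_isSimpleModule (hφmono : Function.Injective φ)
    (hφess : ∀ N : Submodule R E, N ≠ ⊥ → N ⊓ LinearMap.range φ ≠ ⊥)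
    (S : Type) [AddCommGroup S] [Module R S]
    [IsSimpleModule R S] : Module.length R (S →ₗ[R] E) ≤ 1 := by
  cases subsingleton_or_nontrivial (S →ₗ[R] E) with
  | inl h => simp
  | inr h =>
    have : IsSimpleModule R (S →ₗ[R] E) := by
      refine isSimpleModule_iff_toSpanSingleton_surjective.mpr ⟨h, fun ψ hψ χ => ?_⟩
      obtain ⟨s, hs⟩ : ∃ s, ψ s ≠ 0 := by
        by_contra! h0
        exact hψ (LinearMap.ext h0)
      have hs0 : s ≠ 0 := by
        rintro rfl
        exact hs (map_zero ψ)
      have hm : Ideal.IsMaximal (LinearMap.ker (LinearMap.toSpanSingleton R S s)) :=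
        IsSimpleModule.ker_toSpanSingleton_isMaximal R hs0
      have htors (θ : S →ₗ[R] E) :
          ∀ a ∈ LinearMap.ker (LinearMap.toSpanSingleton R S s), a • θ s = 0 := by
        intro a ha
        rw [← map_smul, show a • s = 0 from ha, map_zero]
      obtain ⟨y, hy⟩ := mem_range_of_smul_eq_zero φ hφess _ (htors ψ)
      obtain ⟨z, hz⟩ := mem_range_of_smul_eq_zero φ hφess _ (htors χ)
      obtain ⟨c, hc⟩ := exists_eq_smul_of_smul_eq_zero
        (LinearMap.ker (LinearMap.toSpanSingleton R S s)) (y := y) (z := z)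
        (by rintro rfl; exact hs (by rw [← hy, map_zero]))
        (fun a ha => hφmono (by rw [map_smul, hy, htors ψ a ha, map_zero]))
        (fun a ha => hφmono (by rw [map_smul, hz, htors χ a ha, map_zero]))
      refine ⟨c, LinearMap.ext fun v => ?_⟩
      obtain ⟨r, rfl⟩ := IsSimpleModule.toSpanSingleton_surjective R hs0 v
      simp only [LinearMap.toSpanSingleton_apply, LinearMap.smul_apply, map_smul]
      rw [← hy, ← hz, hc, map_smul]
    rw [Module.length_eq_one]

/-- The duality `Hom(-, E)` does not increase length. -/
lemma length_dual_le (hφmono : Function.Injective φ)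
    (hφess : ∀ N : Submodule R E, N ≠ ⊥ → N ⊓ LinearMap.range φ ≠ ⊥)
    (H : Type) [AddCommGroup H] [Module R H] (hH : IsFiniteLength R H) :
    Module.length R (H →ₗ[R] E) ≤ Module.length R H := by
  induction hH with
  | of_subsingleton => simp
  | @of_simple_quotient H _ _ N _ _ ih =>
    let restr : (H →ₗ[R] E) →ₗ[R] (N →ₗ[R] E) := LinearMap.lcomp R E N.subtype
    let infl : ((H ⧸ N) →ₗ[R] E) →ₗ[R] (H →ₗ[R] E) := LinearMap.lcomp R E N.mkQ
    have hinfl : Function.Injective infl := by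
      intro a b hab
      ext x
      exact LinearMap.congr_fun hab x
    have hex : Function.Exact infl restr.rangeRestrict := by
      intro θ
      constructor
      · intro hθ
        refine ⟨N.liftQ θ fun n hn => ?_, by ext; rfl⟩
        exact LinearMap.congr_fun (congrArg Subtype.val hθ) ⟨n, hn⟩
      · rintro ⟨η, rfl⟩
        apply Subtype.ext
        ext n
        change η (N.mkQ n) = 0
        rw [show N.mkQ (n : H) = 0 from (Submodule.Quotient.mk_eq_zero N).mpr n.2, map_zero]
    rw [Module.length_eq_add_of_exact infl restr.rangeRestrict hinfl
        restr.surjective_rangeRestrict hex,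
      Module.length_eq_add_of_exact N.subtype N.mkQ N.injective_subtype N.mkQ_surjective
        (LinearMap.exact_subtype_mkQ N), add_comm, Module.length_eq_one R (H ⧸ N)]
    exact add_le_add ((Module.length_le_of_injective _ (Submodule.injective_subtype _)).trans ih)
      (length_dual_le_one_of_isSimpleModule φ hφmono hφess (H ⧸ N))

/-- A space of functionals separating the points of a module of finite length is everything. -/
lemma eq_top_of_separating (hφmono : Function.Injective φ)
    (hφess : ∀ N : Submodule R E, N ≠ ⊥ → N ⊓ LinearMap.range φ ≠ ⊥)
    (H : Type) [AddCommGroup H] [Module R H] (hH : IsFiniteLength R H)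
    (S : Submodule R (H →ₗ[R] E)) (hS : ∀ t : H, t ≠ 0 → ∃ s ∈ S, s t ≠ 0) : S = ⊤ := by
  have hle := length_dual_le φ hφmono hφess H hH
  have hfin : IsFiniteLength R (H →ₗ[R] E) :=
    Module.length_ne_top_iff.mp (ne_top_of_le_ne_top (Module.length_ne_top_iff.mpr hH) hle)
  have hSfin : IsFiniteLength R S := hfin.of_injective S.injective_subtype
  let ev : H →ₗ[R] (S →ₗ[R] E) := S.subtype.flip
  have hev : Function.Injective ev := by
    rw [injective_iff_map_eq_zero]
    intro t ht
    by_contra h0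
    obtain ⟨s, hs, hst⟩ := hS t h0
    exact hst (LinearMap.congr_fun ht ⟨s, hs⟩)
  by_contra hne
  obtain ⟨_, _⟩ := isFiniteLength_iff_isNoetherian_isArtinian.mp hfin
  have hlt := Submodule.length_lt hne
  exact absurd ((hle.trans (Module.length_le_of_injective ev hev)).trans
    (length_dual_le φ hφmono hφess S hSfin)) hlt.not_ge

/-- An injective module containing `R` modulo its radical is a cogenerator. -/
lemma exists_functional_ne_zero [IsArtinianRing R] (hφmono : Function.Injective φ)
    (hE : Module.Injective R E)
    {V : Type} [AddCommGroup V] [Module R V] {v : V} (hv : v ≠ 0) :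
    ∃ e : V →ₗ[R] E, e v ≠ 0 := by
  have hker : LinearMap.ker (LinearMap.toSpanSingleton R V v) ≠ ⊤ := by
    intro h
    have h1 : (1 : R) ∈ LinearMap.ker (LinearMap.toSpanSingleton R V v) := h ▸ Submodule.mem_top
    exact hv (by simpa using h1)
  obtain ⟨m, hm, hle⟩ := Ideal.exists_le_maximal _ hker
  obtain ⟨y, hy, hmy⟩ := exists_ne_zero_smul_eq_zero_of_isMaximal m
  let a := (LinearMap.ker (LinearMap.toSpanSingleton R V v)).liftQ
    (LinearMap.toSpanSingleton R V v) le_rfl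
  have ha : Function.Injective a := by
    rw [← LinearMap.ker_eq_bot]
    exact Submodule.ker_liftQ_eq_bot _ _ _ le_rfl
  let b := (LinearMap.ker (LinearMap.toSpanSingleton R V v)).liftQ
    (LinearMap.toSpanSingleton R E (φ y)) fun r hr => by
      simp [← map_smul, hmy r (hle hr)]
  obtain ⟨e, he⟩ := hE.out a ha b
  refine ⟨e, fun h0 => hy (hφmono ?_)⟩
  have h1 := he (Submodule.Quotient.mk 1)
  simp only [a, b, Submodule.liftQ_apply, LinearMap.toSpanSingleton_apply, one_smul] at h1
  rw [← h1, h0, map_zero]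

end Duality

section Lifting

variable {A : Type} [Ring A] {X Y Z N : Type} [AddCommGroup X] [Module A X]
  [AddCommGroup Y] [Module A Y] [AddCommGroup Z] [Module A Z] [AddCommGroup N] [Module A N]

lemma exists_comp_eq_of_exact_of_injective {a : X →ₗ[A] Y} {b : Y →ₗ[A] Z}
    (ha : Function.Injective a) (hab : Function.Exact a b) (t : N →ₗ[A] Y) (ht : b ∘ₗ t = 0) :
    ∃ s : N →ₗ[A] X, a ∘ₗ s = t := by
  have hmem (n : N) : t n ∈ LinearMap.range a := (hab (t n)).mp (LinearMap.congr_fun ht n)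
  refine ⟨(LinearEquiv.ofInjective a ha).symm ∘ₗ t.codRestrict _ hmem, LinearMap.ext fun n => ?_⟩
  have h := (LinearEquiv.ofInjective a ha).apply_symm_apply (t.codRestrict _ hmem n)
  exact congrArg Subtype.val h

lemma exists_comp_eq_of_exact_of_surjective {a : X →ₗ[A] Y} {b : Y →ₗ[A] Z}
    (hb : Function.Surjective b) (hab : Function.Exact a b) (t : Y →ₗ[A] N) (ht : t ∘ₗ a = 0) :
    ∃ s : Z →ₗ[A] N, s ∘ₗ b = t := by
  have hker : LinearMap.ker b ≤ LinearMap.ker t := by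
    intro y hy
    obtain ⟨x, rfl⟩ := (hab y).mp hy
    exact LinearMap.congr_fun ht x
  refine ⟨(LinearMap.ker b).liftQ t hker ∘ₗ (b.quotKerEquivOfSurjective hb).symm,
    LinearMap.ext fun y => ?_⟩
  have h : (b.quotKerEquivOfSurjective hb).symm (b y) = Submodule.Quotient.mk y := by
    rw [LinearEquiv.symm_apply_eq]
    rfl
  simp [h]

end Lifting

section AlmostSplit

variable {A : Type} [Ring A] {M B T P Q : Type} [AddCommGroup M] [Module A M]
  [AddCommGroup B] [Module A B] [AddCommGroup T] [Module A T]
  [AddCommGroup P] [Module A P] [AddCommGroup Q] [Module A Q]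
  {i : M →ₗ[A] B} {p : B →ₗ[A] T} {f : P →ₗ[A] Q} {g : Q →ₗ[A] T}
  {b : Q →ₗ[A] B} {h : P →ₗ[A] M}

/-- The cocycle of a non-split extension does not factor through the presentation. -/
lemma IsAlmostSplitSeq.cocycle_not_factor (hAS : IsAlmostSplitSeq A i p)
    (hg : Function.Surjective g) (hfg : Function.Exact f g) (hb : p ∘ₗ b = g)
    (hh : i ∘ₗ h = b ∘ₗ f) : ¬ ∃ w : Q →ₗ[A] M, w ∘ₗ f = h := by
  rintro ⟨w, rfl⟩
  obtain ⟨⟨-, -, hip⟩, -, hns, -, -⟩ := hAS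
  obtain ⟨s, hs⟩ := exists_comp_eq_of_exact_of_surjective hg hfg (b - i ∘ₗ w) (by
    rw [LinearMap.sub_comp, LinearMap.comp_assoc, hh, sub_self])
  refine hns ⟨s, ?_⟩
  rw [← LinearMap.cancel_right hg, LinearMap.comp_assoc, hs, LinearMap.comp_sub, hb,
    ← LinearMap.comp_assoc, hip.linearMap_comp_eq_zero, LinearMap.zero_comp, sub_zero,
    LinearMap.id_comp]

variable {N : Type} [AddCommGroup N] [Module A N]

/-- A map `u` vanishing on the kernel of `f` and not factoring through `f` defines a non-split
extension of `T`, hence it can be pushed forward to the almost split one. -/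
lemma IsAlmostSplitSeq.exists_pushforward_of_ker_le (hAS : IsAlmostSplitSeq A i p)
    [Module.Finite A N] [Module.Finite A Q]
    (hfg : Function.Exact f g) (hb : p ∘ₗ b = g)
    (hh : i ∘ₗ h = b ∘ₗ f) (u : P →ₗ[A] N) (hker : LinearMap.ker f ≤ LinearMap.ker u)
    (hu : ¬ ∃ w : Q →ₗ[A] N, w ∘ₗ f = u) :
    ∃ (t : N →ₗ[A] M) (w : Q →ₗ[A] M), t ∘ₗ u = h - w ∘ₗ f := by
  obtain ⟨⟨hi, -, hip⟩, -, -, hlift, -⟩ := hAS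
  let K : Submodule A (Q × N) := LinearMap.range (f.prod (-u))
  let j : N →ₗ[A] (Q × N) ⧸ K := K.mkQ ∘ₗ LinearMap.inr A Q N
  let q : Q →ₗ[A] (Q × N) ⧸ K := K.mkQ ∘ₗ LinearMap.inl A Q N
  let ρ : ((Q × N) ⧸ K) →ₗ[A] T := K.liftQ (g ∘ₗ LinearMap.fst A Q N) (by
    rintro _ ⟨x, rfl⟩
    exact hfg.apply_apply_eq_zero x)
  have hρj : ρ ∘ₗ j = 0 := by
    ext n
    simp [ρ, j]
  have hρq : ρ ∘ₗ q = g := by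
    ext n
    simp [ρ, q]
  have hqf : q ∘ₗ f = j ∘ₗ u := by
    ext x
    refine (Submodule.Quotient.eq K).mpr ⟨x, ?_⟩
    simp
  have hj : Function.Injective j := by
    rw [injective_iff_map_eq_zero]
    intro n hn
    obtain ⟨x, hx⟩ := (Submodule.Quotient.mk_eq_zero K).mp hn
    obtain ⟨hx1, hx2⟩ := Prod.ext_iff.mp hx
    have hux : u x = 0 := hker hx1
    simpa [hux] using hx2.symm
  have hjρ : Function.Exact j ρ := by
    intro c
    refine ⟨fun hc => ?_, ?_⟩
    · obtain ⟨⟨a, n⟩, rfl⟩ := Submodule.Quotient.mk_surjective K c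
      obtain ⟨x, rfl⟩ := (hfg a).mp hc
      refine ⟨n + u x, (Submodule.Quotient.eq K).mpr ⟨-x, ?_⟩⟩
      simp
    · rintro ⟨n, rfl⟩
      exact LinearMap.congr_fun hρj n
  clear_value j q ρ
  have hns : ¬ ∃ s : T →ₗ[A] (Q × N) ⧸ K, ρ ∘ₗ s = LinearMap.id := by
    rintro ⟨s, hs⟩
    obtain ⟨w, hw⟩ := exists_comp_eq_of_exact_of_injective hj hjρ (q - s ∘ₗ g) (by
      rw [LinearMap.comp_sub, hρq, ← LinearMap.comp_assoc, hs, LinearMap.id_comp, sub_self])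
    refine hu ⟨w, ?_⟩
    rw [← LinearMap.cancel_left hj, ← LinearMap.comp_assoc, hw, LinearMap.sub_comp,
      LinearMap.comp_assoc, hfg.linearMap_comp_eq_zero, LinearMap.comp_zero, sub_zero, hqf]
  obtain ⟨l, hl⟩ := hlift _ ρ hns
  obtain ⟨t, ht⟩ := exists_comp_eq_of_exact_of_injective hi hip (l ∘ₗ j) (by
    rw [← LinearMap.comp_assoc, hl, hρj])
  obtain ⟨w, hw⟩ := exists_comp_eq_of_exact_of_injective hi hip (b - l ∘ₗ q) (by
    rw [LinearMap.comp_sub, hb, ← LinearMap.comp_assoc, hl, hρq, sub_self])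
  refine ⟨t, w, ?_⟩
  rw [← LinearMap.cancel_left hi, LinearMap.comp_sub, ← LinearMap.comp_assoc, ht,
    ← LinearMap.comp_assoc, hw, hh, LinearMap.sub_comp, LinearMap.comp_assoc,
    LinearMap.comp_assoc, hqf]
  abel

/-- If `f` is a projective cover of its image, the vanishing condition on `u` can be dropped. -/
lemma IsAlmostSplitSeq.exists_pushforward (hAS : IsAlmostSplitSeq A i p)
    [Module.Finite A N] [Module.Finite A Q] [Module.Projective A Q]
    (hfg : Function.Exact f g) (hb : p ∘ₗ b = g)
    (hh : i ∘ₗ h = b ∘ₗ f)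
    (hcover : ∀ L : Submodule A P, L ⊔ LinearMap.ker f = ⊤ → L = ⊤) (u : P →ₗ[A] N)
    (hu : ¬ ∃ w : Q →ₗ[A] N, w ∘ₗ f = u) :
    ∃ (t : N →ₗ[A] M) (w : Q →ₗ[A] M), t ∘ₗ u = h - w ∘ₗ f := by
  let U : Submodule A N := (LinearMap.ker f).map u
  obtain ⟨t, w, htw⟩ := hAS.exists_pushforward_of_ker_le hfg hb hh (U.mkQ ∘ₗ u)
    (fun x hx => (Submodule.Quotient.mk_eq_zero U).mpr ⟨x, hx, rfl⟩) (by
      rintro ⟨w, hw⟩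
      obtain ⟨w', rfl⟩ := Module.projective_lifting_property U.mkQ w U.mkQ_surjective
      refine hu ⟨w', ?_⟩
      have hdiff (x : P) : (u - w' ∘ₗ f) x ∈ U := by
        rw [← Submodule.Quotient.mk_eq_zero U, LinearMap.sub_apply, Submodule.Quotient.mk_sub,
          sub_eq_zero]
        exact (LinearMap.congr_fun hw x).symm
      have htop : LinearMap.ker (u - w' ∘ₗ f) = ⊤ := by
        refine hcover _ (eq_top_iff.mpr fun x _ => ?_)
        obtain ⟨y, hy, hyx⟩ := hdiff x
        refine Submodule.mem_sup.mpr ⟨x - y, ?_, y, hy, sub_add_cancel x y⟩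
        rw [LinearMap.mem_ker, map_sub, ← hyx, LinearMap.sub_apply, LinearMap.comp_apply,
          show f y = 0 from hy, map_zero, sub_zero, sub_self]
      exact (sub_eq_zero.mp (LinearMap.ker_eq_top.mp htop)).symm)
  exact ⟨t ∘ₗ U.mkQ, w, htw⟩

/-- The cocycle of the almost split sequence is cohomologous to one with values in any given
nonzero submodule of `M`. -/
lemma IsAlmostSplitSeq.exists_cocycle_factor (hAS : IsAlmostSplitSeq A i p)
    [Module.Finite A M] [Module.Projective A P] [Module.Projective A Q]
    (hh : i ∘ₗ h = b ∘ₗ f) (t : N →ₗ[A] M) (ht : t ≠ 0) :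
    ∃ (u : P →ₗ[A] N) (w : Q →ₗ[A] M), t ∘ₗ u = h - w ∘ₗ f := by
  obtain ⟨-, -, -, -, hext⟩ := hAS
  let L := LinearMap.range t
  obtain ⟨l, hl⟩ := hext (M ⧸ L) L.mkQ (by
    rintro ⟨r, hr⟩
    refine ht (LinearMap.ext fun n => ?_)
    have h0 : L.mkQ (t n) = 0 := (Submodule.Quotient.mk_eq_zero L).mpr ⟨n, rfl⟩
    have h1 := LinearMap.congr_fun hr (t n)
    rw [LinearMap.comp_apply, h0, map_zero] at h1
    exact h1.symm)
  obtain ⟨w, hw⟩ := Module.projective_lifting_property L.mkQ (l ∘ₗ b) L.mkQ_surjective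
  have hmem (x : P) : (h - w ∘ₗ f) x ∈ L := by
    rw [← Submodule.Quotient.mk_eq_zero L, LinearMap.sub_apply, Submodule.Quotient.mk_sub,
      sub_eq_zero]
    have h1 := LinearMap.congr_fun hl (h x)
    have h2 := LinearMap.congr_fun hh x
    have h3 := LinearMap.congr_fun hw (f x)
    simp only [LinearMap.comp_apply, Submodule.mkQ_apply] at h1 h2 h3 ⊢
    rw [← h1, h2, h3]
  obtain ⟨u, hu⟩ := Module.projective_lifting_property t.rangeRestrict
    ((h - w ∘ₗ f).codRestrict L hmem) t.surjective_rangeRestrict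
  refine ⟨u, w, LinearMap.ext fun x => ?_⟩
  exact congrArg Subtype.val (LinearMap.congr_fun hu x)

end AlmostSplit

lemma isFiniteLength_hom (R : Type) [CommRing R] [IsArtinianRing R] (A : Type) [Ring A]
    [Algebra R A] [Module.Finite R A] (N M : Type)
    [AddCommGroup N] [Module R N] [Module A N] [IsScalarTower R A N] [Module.Finite A N]
    [AddCommGroup M] [Module R M] [Module A M] [IsScalarTower R A M] [SMulCommClass A R M]
    [Module.Finite A M] : IsFiniteLength R (N →ₗ[A] M) := by
  have := Module.Finite.trans (R := R) A N
  have := Module.Finite.trans (R := R) A M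
  let res : (N →ₗ[A] M) →ₗ[R] (N →ₗ[R] M) :=
    { toFun := fun t => t.restrictScalars R
      map_add' := fun _ _ => rfl
      map_smul' := fun _ _ => rfl }
  have hfin : IsFiniteLength R (N →ₗ[R] M) :=
    isFiniteLength_iff_isNoetherian_isArtinian.mpr ⟨inferInstance, inferInstance⟩
  exact hfin.of_injective (f := res) (LinearMap.restrictScalars_injective R)

theorem statement13 [IsArtinianRing k] [Module.Finite k Λ]
    -- the injective envelope E of k/r and the duality D = Hom_k(−,E)
    (E : Type) [AddCommGroup E] [Module k E] (hEinj : Module.Injective k E)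
    (φ : (k ⧸ Ideal.jacobson (⊥ : Ideal k)) →ₗ[k] E)
    (hφmono : Function.Injective φ)
    (hφess : ∀ N : Submodule k E, N ≠ ⊥ → N ⊓ LinearMap.range φ ≠ ⊥)
    -- M : an indecomposable non-projective finitely generated Λ-module
    (M : Type) [AddCommGroup M] [Module k M] [Module Λ M] [IsScalarTower k Λ M]
      [SMulCommClass Λ k M] [Module.Finite Λ M]
    (hMind : IndecMod Λ M) (hMnp : ¬ Module.Projective Λ M)
    -- almost split sequence 0 → M → B → T → 0  (so T = τ⁻¹(M))
    (B : Type) [AddCommGroup B] [Module Λ B] [Module.Finite Λ B]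
    (T : Type) [AddCommGroup T] [Module Λ T] [Module.Finite Λ T]
    (i : M →ₗ[Λ] B) (p : B →ₗ[Λ] T) (hAS : IsAlmostSplitSeq Λ i p)
    -- minimal projective presentation P →f Q →g T → 0 of T
    (P : Type) [AddCommGroup P] [Module Λ P] [Module.Finite Λ P]
    (Q : Type) [AddCommGroup Q] [Module Λ Q] [Module.Finite Λ Q]
    (f : P →ₗ[Λ] Q) (g : Q →ₗ[Λ] T)
    (hP : Module.Projective Λ P) (hQ : Module.Projective Λ Q)
    (hgsurj : Function.Surjective g) (hexact : Function.Exact f g)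
    (hcover_g : ∀ N : Submodule Λ Q, N ⊔ LinearMap.ker g = ⊤ → N = ⊤)
    (hcover_f : ∀ N : Submodule Λ P, N ⊔ LinearMap.ker f = ⊤ → N = ⊤) :
    -- conclusion: a natural transformation ε : Hom_Λ(P,−) → D∘Hom_Λ(−,M) with the
    -- stated four-term exact sequences
    ∃ ε : ∀ (N : Type) [AddCommGroup N] [Module k N] [Module Λ N] [IsScalarTower k Λ N]
        [SMulCommClass Λ k N] [Module.Finite Λ N],
        (P →ₗ[Λ] N) →ₗ[k] ((N →ₗ[Λ] M) →ₗ[k] E),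
      -- ε is natural in N
      (∀ (N : Type) [AddCommGroup N] [Module k N] [Module Λ N] [IsScalarTower k Λ N]
          [SMulCommClass Λ k N] [Module.Finite Λ N]
        (N' : Type) [AddCommGroup N'] [Module k N'] [Module Λ N'] [IsScalarTower k Λ N']
          [SMulCommClass Λ k N'] [Module.Finite Λ N']
        (α : N →ₗ[Λ] N') (u : P →ₗ[Λ] N) (t : N' →ₗ[Λ] M),
          ε N' (α ∘ₗ u) t = ε N u (t ∘ₗ α)) ∧
      -- for every finitely generated N, the sequence
      -- 0 → Hom(T,N) → Hom(Q,N) → Hom(P,N) → D(Hom(N,M)) → 0 is exact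
      (∀ (N : Type) [AddCommGroup N] [Module k N] [Module Λ N] [IsScalarTower k Λ N]
          [SMulCommClass Λ k N] [Module.Finite Λ N],
        Function.Injective (fun t : T →ₗ[Λ] N => t ∘ₗ g) ∧
        Function.Exact (fun t : T →ₗ[Λ] N => t ∘ₗ g)
          (fun u : Q →ₗ[Λ] N => u ∘ₗ f) ∧
        Function.Exact (fun u : Q →ₗ[Λ] N => u ∘ₗ f) (ε N) ∧
        Function.Surjective (ε N)) := by
  obtain ⟨⟨hi, hp, hip⟩, -⟩ := id hAS
  obtain ⟨b, hb⟩ := Module.projective_lifting_property p g hp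
  obtain ⟨h, hh⟩ := exists_comp_eq_of_exact_of_injective hi hip (b ∘ₗ f) (by
    rw [← LinearMap.comp_assoc, hb, hexact.linearMap_comp_eq_zero])
  let Y : Submodule k (P →ₗ[Λ] M) := LinearMap.range
    ({ toFun := fun w => w ∘ₗ f
       map_add' := fun _ _ => rfl
       map_smul' := fun _ _ => rfl } : (Q →ₗ[Λ] M) →ₗ[k] (P →ₗ[Λ] M))
  have hhY : Y.mkQ h ≠ 0 := fun h0 =>
    hAS.cocycle_not_factor hgsurj hexact hb hh ((Submodule.Quotient.mk_eq_zero Y).mp h0)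
  obtain ⟨e', he'⟩ := exists_functional_ne_zero φ hφmono hEinj hhY
  let e : (P →ₗ[Λ] M) →ₗ[k] E := e' ∘ₗ Y.mkQ
  have heY (w : Q →ₗ[Λ] M) : e (w ∘ₗ f) = 0 := by
    have h0 : Y.mkQ (w ∘ₗ f) = 0 := (Submodule.Quotient.mk_eq_zero Y).mpr ⟨w, rfl⟩
    rw [LinearMap.comp_apply, h0, map_zero]
  have heh (x : P →ₗ[Λ] M) (hx : ∃ w : Q →ₗ[Λ] M, x = h - w ∘ₗ f) : e x ≠ 0 := by
    obtain ⟨w, rfl⟩ := hx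
    rw [map_sub, heY, sub_zero]
    exact he'
  refine ⟨fun N _ _ _ _ _ _ => LinearMap.mk₂ k (fun u t => e (t ∘ₗ u))
    (fun u u' t => by rw [LinearMap.comp_add, map_add])
    (fun c u t => by rw [← map_smul]; congr 1; ext x; simp [LinearMap.map_smul_of_tower])
    (fun u t t' => by rw [LinearMap.add_comp, map_add])
    (fun c u t => by rw [← map_smul]; rfl), ?_, ?_⟩
  · intro N _ _ _ _ _ _ N' _ _ _ _ _ _ α u t
    rfl
  · intro N _ _ _ _ _ _
    refine ⟨fun s t hst => (LinearMap.cancel_right hgsurj).mp hst, fun u => ⟨fun hu => ?_, ?_⟩,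
      fun u => ⟨fun hu => ?_, ?_⟩, ?_⟩
    · exact exists_comp_eq_of_exact_of_surjective hgsurj hexact u hu
    · rintro ⟨t, rfl⟩
      change (t ∘ₗ g) ∘ₗ f = 0
      rw [LinearMap.comp_assoc, hexact.linearMap_comp_eq_zero, LinearMap.comp_zero]
    · by_contra hno
      obtain ⟨t, w, htw⟩ := hAS.exists_pushforward hexact hb hh hcover_f u hno
      exact heh (t ∘ₗ u) ⟨w, htw⟩ (LinearMap.congr_fun hu t)
    · rintro ⟨w, rfl⟩
      ext t
      exact heY (t ∘ₗ w)
    · rw [← LinearMap.range_eq_top]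
      refine eq_top_of_separating φ hφmono hφess _ (isFiniteLength_hom k Λ N M) _ fun t ht => ?_
      obtain ⟨u, w, huw⟩ := hAS.exists_cocycle_factor hh t ht
      exact ⟨_, ⟨u, rfl⟩, heh (t ∘ₗ u) ⟨w, huw⟩⟩

end Statement13
end
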